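/- Let T be a squarefree semisimple Λ-module with exactly t simple direct summands, let P be a projective cover of T, let C ⊆ JP be a Λ-submodule, and set M = P/C. Then M has no proper top-stable degeneration if and only if M is a direct sum of local modules and μ_T(M) = t + dim_K Hom_Λ(M, JM). -/

import Mathlib

open Module

/-- The Jacobson radical `J` of the ring `Λ` (intersection of the maximal left ideals). -/
noncomputable def jacRad (Λ : Type) [Ring Λ] : Ideal Λ := Ideal.jacobson ⊥

/-- The submodule `J • M` of a `Λ`-module `M`. -/
noncomputable def jrad (Λ : Type) [Ring Λ] (M : Type) [AddCommGroup M] [Module Λ M] :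
    Submodule Λ M :=
  Submodule.span Λ {x : M | ∃ a ∈ jacRad Λ, ∃ m : M, a • m = x}

/-- The underlying space of the `d`-dimensional representation `ρ : Λ →ₐ[K] M_d(K)`. -/
def RepSpace (K : Type) [Field K] (d : ℕ) {Λ : Type} [Ring Λ] [Algebra K Λ]
    (ρ : Λ →ₐ[K] Matrix (Fin d) (Fin d) K) : Type := Fin d → K

section RepSpace
variable (K : Type) [Field K] (d : ℕ) {Λ : Type} [Ring Λ] [Algebra K Λ]
  (ρ : Λ →ₐ[K] Matrix (Fin d) (Fin d) K)

instance : AddCommGroup (RepSpace K d ρ) := inferInstanceAs (AddCommGroup (Fin d → K))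
instance : Module K (RepSpace K d ρ) := inferInstanceAs (Module K (Fin d → K))

/-- The `Λ`-module structure on `K^d` induced by the representation `ρ`. -/
noncomputable instance RepSpace.moduleLambda : Module Λ (RepSpace K d ρ) :=
  Module.compHom (Fin d → K)
    ((Matrix.toLinAlgEquiv' :
        Matrix (Fin d) (Fin d) K ≃ₐ[K] Module.End K (Fin d → K)).toAlgHom.toRingHom.comp
      ρ.toRingHom)

instance : IsScalarTower K Λ (RepSpace K d ρ) := by
  constructor
  intro k a v
  show (Matrix.toLinAlgEquiv'.toAlgHom.toRingHom.comp ρ.toRingHom (k • a)) v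
      = k • ((Matrix.toLinAlgEquiv'.toAlgHom.toRingHom.comp ρ.toRingHom a) v)
  have h : (Matrix.toLinAlgEquiv'.toAlgHom.toRingHom.comp ρ.toRingHom (k • a))
      = k • (Matrix.toLinAlgEquiv'.toAlgHom.toRingHom.comp ρ.toRingHom a) := by
    simp [map_smul]
  rw [h]; rfl

end RepSpace

/-- `M_τ` is a degeneration of `M_ρ`: having fixed a `K`-basis `b` of `Λ` (which identifies the
space of `K`-linear maps `Λ → M_d(K)` with an affine space with polynomial coordinate
functions indexed by `ι × Fin d × Fin d`), the point `τ` lies in the Zariski closure (the zero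
locus of all polynomials vanishing on the orbit) of the conjugation orbit of `ρ` under
`GL_d(K)`. -/
def IsDegeneration {K Λ ι : Type} [Field K] [Ring Λ] [Algebra K Λ] [Fintype ι]
    (b : Basis ι K Λ) (d : ℕ) (ρ τ : Λ →ₐ[K] Matrix (Fin d) (Fin d) K) : Prop :=
  ∀ p : MvPolynomial (ι × Fin d × Fin d) K,
    (∀ g : GL (Fin d) K,
      MvPolynomial.eval
        (fun x => ((g : Matrix (Fin d) (Fin d) K) * ρ (b x.1) *
            ((g⁻¹ : GL (Fin d) K) : Matrix (Fin d) (Fin d) K)) x.2.1 x.2.2) p = 0) →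
    MvPolynomial.eval (fun x => τ (b x.1) x.2.1 x.2.2) p = 0



section PartA

variable {Λ : Type} [Ring Λ]
variable {M N A B Y : Type} [AddCommGroup M] [Module Λ M] [AddCommGroup N] [Module Λ N]
  [AddCommGroup A] [Module Λ A] [AddCommGroup B] [Module Λ B] [AddCommGroup Y] [Module Λ Y]

lemma jrad_eq : jrad Λ M = Ring.jacobson Λ • (⊤ : Submodule Λ M) := by
  apply le_antisymm
  · refine Submodule.span_le.2 ?_
    rintro x ⟨a, ha, m, rfl⟩
    rw [jacRad, Ideal.jacobson_bot] at ha
    exact Submodule.smul_mem_smul ha trivial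
  · refine Submodule.smul_le.2 fun a ha m _ => Submodule.subset_span ⟨a, ?_, m, rfl⟩
    rwa [jacRad, Ideal.jacobson_bot]

lemma jrad_map_le (f : M →ₗ[Λ] N) : (jrad Λ M).map f ≤ jrad Λ N := by
  rw [jrad_eq, jrad_eq, Submodule.map_smul'']
  exact Submodule.smul_mono le_rfl le_top

lemma jrad_apply (f : M →ₗ[Λ] N) {x : M} (hx : x ∈ jrad Λ M) : f x ∈ jrad Λ N :=
  jrad_map_le f (Submodule.mem_map_of_mem hx)

lemma jrad_map_surj (f : M →ₗ[Λ] N) (hf : Function.Surjective f) :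
    (jrad Λ M).map f = jrad Λ N := by
  rw [jrad_eq, jrad_eq, Submodule.map_smul'', Submodule.map_top, LinearMap.range_eq_top.2 hf]

lemma equiv_of_ker_eq (f : Y →ₗ[Λ] A) (g : Y →ₗ[Λ] B) (hf : Function.Surjective f)
    (hg : Function.Surjective g) (h : LinearMap.ker f = LinearMap.ker g) :
    Nonempty (A ≃ₗ[Λ] B) :=
  ⟨(f.quotKerEquivOfSurjective hf).symm.trans
    ((Submodule.quotEquivOfEq _ _ h).trans (g.quotKerEquivOfSurjective hg))⟩

lemma top_equiv_of (q : Y →ₗ[Λ] N) (hq : Function.Surjective q) (g : Y →ₗ[Λ] B)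
    (hg : Function.Surjective g) (h : LinearMap.ker g = jrad Λ Y ⊔ LinearMap.ker q) :
    Nonempty ((N ⧸ jrad Λ N) ≃ₗ[Λ] B) := by
  refine equiv_of_ker_eq ((jrad Λ N).mkQ.comp q) g
    ((Submodule.mkQ_surjective _).comp hq) hg ?_
  rw [LinearMap.ker_comp, Submodule.ker_mkQ, ← jrad_map_surj q hq, Submodule.comap_map_eq, h]

lemma top_equiv_of_ker_le (q : Y →ₗ[Λ] N) (hq : Function.Surjective q)
    (h : LinearMap.ker q ≤ jrad Λ Y) :
    Nonempty ((N ⧸ jrad Λ N) ≃ₗ[Λ] (Y ⧸ jrad Λ Y)) :=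
  top_equiv_of q hq (jrad Λ Y).mkQ (Submodule.mkQ_surjective _)
    (by rw [Submodule.ker_mkQ, sup_eq_left.2 h])

lemma top_equiv_of_equiv (e : M ≃ₗ[Λ] N) :
    Nonempty ((N ⧸ jrad Λ N) ≃ₗ[Λ] (M ⧸ jrad Λ M)) :=
  top_equiv_of_ker_le e.toLinearMap e.surjective (by simp)

lemma nakayama_surj [Module.Finite Λ N] (f : M →ₗ[Λ] N)
    (h : LinearMap.range f ⊔ jrad Λ N = ⊤) : Function.Surjective f := by
  rw [← LinearMap.range_eq_top]
  suffices hs : (⊤ : Submodule Λ (N ⧸ LinearMap.range f)) = ⊥ by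
    rw [← Submodule.ker_mkQ (LinearMap.range f), LinearMap.ker_eq_top]
    ext x
    have : (LinearMap.range f).mkQ x ∈ (⊤ : Submodule Λ (N ⧸ LinearMap.range f)) := trivial
    rw [hs] at this
    simpa using this
  apply Submodule.FG.eq_bot_of_le_jacobson_smul Module.Finite.fg_top
  rw [← jrad_eq, ← jrad_map_surj _ (Submodule.mkQ_surjective (LinearMap.range f))]
  have := congrArg (Submodule.map (LinearMap.range f).mkQ) h
  rw [Submodule.map_sup, Submodule.map_top, Submodule.range_mkQ] at this
  rw [← this]
  simp

lemma jrad_semisimple [IsSemisimpleModule Λ M] : jrad Λ M = ⊥ := by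
  rw [jrad_eq, eq_bot_iff]
  refine Submodule.smul_le.2 fun a ha m _ => ?_
  exact (Module.mem_annihilator.1 (IsSemisimpleModule.jacobson_le_annihilator Λ M ha) m)

lemma semisimple_top [IsArtinianRing Λ] : IsSemisimpleModule Λ (M ⧸ jrad Λ M) := by
  have h : Module.IsTorsionBySet Λ (M ⧸ jrad Λ M) (Ring.jacobson Λ) := by
    rw [Module.isTorsionBySet_quotient_iff, jrad_eq]
    exact fun m i hi => Submodule.smul_mem_smul hi trivial
  let _ := h.module
  exact (h.semilinearMap.isSemisimpleModule_iff_of_bijective Function.bijective_id).2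
      inferInstance

lemma jrad_prod {u : A} {v : B} :
    (u, v) ∈ jrad Λ (A × B) ↔ u ∈ jrad Λ A ∧ v ∈ jrad Λ B := by
  constructor
  · intro h
    exact ⟨jrad_apply (LinearMap.fst Λ A B) h, jrad_apply (LinearMap.snd Λ A B) h⟩
  · rintro ⟨h1, h2⟩
    have := add_mem (jrad_apply (LinearMap.inl Λ A B) h1) (jrad_apply (LinearMap.inr Λ A B) h2)
    simpa using this

lemma jrad_ne_top [Nontrivial M] [Module.Finite Λ M] : jrad Λ M ≠ ⊤ := by
  intro h
  have : Function.Surjective (0 : M →ₗ[Λ] M) := nakayama_surj _ (by simp [h])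
  obtain ⟨x, hx⟩ := exists_ne (0 : M)
  obtain ⟨y, hy⟩ := this x
  exact hx hy.symm

lemma exists_local [IsArtinianRing Λ] [Nontrivial Y] [Module.Finite Λ Y] :
    ∃ L : Submodule Λ Y, L ≠ ⊥ ∧ IsSimpleModule Λ (L ⧸ jrad Λ L) ∧
      L ⊓ jrad Λ Y ≤ (jrad Λ L).map L.subtype := by
  have : IsArtinian Λ Y := inferInstance
  obtain ⟨L, hL, hmin⟩ := wellFounded_lt.has_min {L : Submodule Λ Y | ¬ L ≤ jrad Λ Y}
    ⟨⊤, fun h => jrad_ne_top (top_le_iff.1 h)⟩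
  have hle : ∀ V : Submodule Λ L, V ≠ ⊤ → V.map L.subtype ≤ jrad Λ Y := by
    intro V hV
    by_contra hcon
    apply hmin _ hcon
    refine lt_of_le_of_ne (Submodule.map_subtype_le L V) fun h => hV ?_
    rw [← Submodule.comap_map_eq_of_injective L.injective_subtype V, h]
    simp
  have hLbot : L ≠ ⊥ := by
    rintro rfl
    exact hL bot_le
  have : Nontrivial L := Submodule.nontrivial_iff_ne_bot.2 hLbot
  have hss : IsSemisimpleModule Λ (L ⧸ jrad Λ L) := semisimple_top
  set X : Submodule Λ L := (jrad Λ Y).comap L.subtype with hX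
  have hXtop : X ≠ ⊤ := by
    intro h
    apply hL
    intro x hx
    have : (⟨x, hx⟩ : L) ∈ X := by rw [h]; trivial
    exact this
  have hJX : jrad Λ L ≤ X := fun x hx => jrad_apply L.subtype hx
  have hmax : ∀ V : Submodule Λ L, V ≠ ⊤ → V ≤ X := fun V hV x hx =>
    hle V hV (Submodule.mem_map_of_mem hx)
  -- X equals J L
  have hXJ : X ≤ jrad Λ L := by
    obtain ⟨W, hW⟩ := exists_isCompl (X.map (jrad Λ L).mkQ)
    by_cases hWt : W.comap (jrad Λ L).mkQ = ⊤
    · have hW' : W = ⊤ := by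
        have := congrArg (Submodule.map (jrad Λ L).mkQ) hWt
        rwa [Submodule.map_comap_eq_of_surjective (Submodule.mkQ_surjective _), Submodule.map_top,
          Submodule.range_mkQ] at this
      have : X.map (jrad Λ L).mkQ = ⊥ := by simpa [hW'] using hW.inf_eq_bot
      intro x hx
      have h' : (jrad Λ L).mkQ x ∈ X.map (jrad Λ L).mkQ := Submodule.mem_map_of_mem hx
      rw [this, Submodule.mem_bot, Submodule.mkQ_apply, Submodule.Quotient.mk_eq_zero] at h'
      exact h'
    · exfalso
      have h1 := hmax _ hWt
      have h2 : W ≤ X.map (jrad Λ L).mkQ := by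
        rw [← Submodule.map_comap_eq_of_surjective (Submodule.mkQ_surjective (jrad Λ L)) W]
        exact Submodule.map_mono h1
      have h3 : X.map (jrad Λ L).mkQ = ⊤ := by
        rw [← hW.sup_eq_top, sup_eq_left.2 h2]
      apply hXtop
      have := congrArg (Submodule.comap (jrad Λ L).mkQ) h3
      rw [Submodule.comap_map_eq, Submodule.ker_mkQ, sup_eq_left.2 hJX, Submodule.comap_top] at this
      exact this
  refine ⟨L, hLbot, ?_, ?_⟩
  · rw [isSimpleModule_iff_isCoatom]
    have : jrad Λ L = X := le_antisymm hJX hXJ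
    rw [this]
    refine ⟨hXtop, fun V hV => ?_⟩
    by_contra h
    exact absurd (hmax V h) (not_le_of_gt hV)
  · rintro x ⟨hx, hx'⟩
    exact ⟨⟨x, hx⟩, hXJ hx', rfl⟩

/-- `J^k M`. -/
noncomputable def jpow (k : ℕ) (M : Type) [AddCommGroup M] [Module Λ M] : Submodule Λ M :=
  (Ring.jacobson Λ ^ k) • (⊤ : Submodule Λ M)

lemma jpow_map_surj (k : ℕ) (f : M →ₗ[Λ] N) (hf : Function.Surjective f) :
    (jpow (Λ := Λ) k M).map f = jpow k N := by
  rw [jpow, jpow, Submodule.map_smul'', Submodule.map_top, LinearMap.range_eq_top.2 hf]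

lemma jpow_zero : jpow (Λ := Λ) 0 M = ⊤ := by
  rw [jpow, Submodule.pow_zero, Ideal.one_eq_top, Submodule.top_smul]

lemma jpow_one : jpow (Λ := Λ) 1 M = jrad Λ M := by
  rw [jpow, Submodule.pow_one, jrad_eq]

lemma jpow_add_map (f : M →ₗ[Λ] M) (k l : ℕ)
    (hf : LinearMap.range f ≤ jpow (Λ := Λ) k M) :
    (jpow (Λ := Λ) l M).map f ≤ jpow (l + k) M := by
  rw [jpow, Submodule.map_smul'', Submodule.map_top, jpow]
  rcases Nat.eq_zero_or_pos k with rfl | hk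
  · simpa using Submodule.smul_mono le_rfl le_top
  · rw [Submodule.pow_add _ hk.ne', Submodule.mul_smul]
    exact Submodule.smul_mono le_rfl hf

lemma jpow_anti : Antitone (fun k => jpow (Λ := Λ) k M) := by
  refine antitone_nat_of_succ_le fun k => ?_
  rcases Nat.eq_zero_or_pos k with rfl | hk
  · rw [jpow_zero]; exact le_top
  · simp only [jpow]
    exact Submodule.smul_mono_left (Ideal.pow_le_pow_right (Nat.le_succ k))

lemma jpow_eventually [IsArtinianRing Λ] : ∃ n, ∀ (M : Type) [AddCommGroup M] [Module Λ M],
    jpow (Λ := Λ) n M = ⊥ := by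
  obtain ⟨n, hn⟩ := IsSemiprimaryRing.isNilpotent (R := Λ)
  refine ⟨n, fun M _ _ => ?_⟩
  rw [jpow, hn]
  simp

end PartA

section PartB

variable {K Λ : Type} [Field K] [Ring Λ] [Algebra K Λ]
variable {M N Y : Type} [AddCommGroup M] [Module Λ M] [Module K M] [IsScalarTower K Λ M]
  [AddCommGroup N] [Module Λ N] [Module K N] [IsScalarTower K Λ N]
  [AddCommGroup Y] [Module Λ Y] [Module K Y] [IsScalarTower K Λ Y]

lemma clear_denoms {σ : Type} (p : MvPolynomial σ K) (f : σ → Polynomial K) (δ : Polynomial K) :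
    ∃ (n : ℕ) (q : Polynomial K), ∀ s, δ.eval s ≠ 0 →
      q.eval s = (δ.eval s) ^ n *
        MvPolynomial.eval (fun x => (δ.eval s)⁻¹ * (f x).eval s) p := by
  induction p using MvPolynomial.induction_on with
  | C a => exact ⟨0, Polynomial.C a, fun s _ => by simp⟩
  | add p q hp hq =>
    obtain ⟨n, a, ha⟩ := hp
    obtain ⟨m, b, hb⟩ := hq
    refine ⟨n + m, δ ^ m * a + δ ^ n * b, fun s hs => ?_⟩
    simp only [Polynomial.eval_add, Polynomial.eval_mul, Polynomial.eval_pow, ha s hs, hb s hs,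
      map_add]
    ring
  | mul_X p x hp =>
    obtain ⟨n, a, ha⟩ := hp
    refine ⟨n + 1, a * f x, fun s hs => ?_⟩
    simp only [Polynomial.eval_mul, ha s hs, map_mul, MvPolynomial.eval_X]
    generalize MvPolynomial.eval (fun x => (δ.eval s)⁻¹ * (f x).eval s) p = E
    rw [pow_succ]
    field_simp

lemma eval_zero_of [Infinite K] {σ : Type} (p : MvPolynomial σ K) (f : σ → Polynomial K)
    (δ : Polynomial K) (hδ : δ.eval 0 ≠ 0)
    (H : ∀ s, s ≠ 0 → δ.eval s ≠ 0 →
      MvPolynomial.eval (fun x => (δ.eval s)⁻¹ * (f x).eval s) p = 0) :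
    MvPolynomial.eval (fun x => (δ.eval 0)⁻¹ * (f x).eval 0) p = 0 := by
  obtain ⟨n, q, hq⟩ := clear_denoms p f δ
  have hz : q * (Polynomial.X * δ) = 0 := by
    apply Polynomial.funext
    intro s
    by_cases hs : s = 0
    · simp [hs]
    by_cases hs' : δ.eval s = 0
    · simp [hs']
    simp [hq s hs', H s hs hs']
  have hδ0 : δ ≠ 0 := by rintro rfl; simp at hδ
  have hq0 : q = 0 := by
    rcases mul_eq_zero.1 hz with h | h
    · exact h
    · exact absurd h (mul_ne_zero Polynomial.X_ne_zero hδ0)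
  have := hq 0 hδ
  rw [hq0, Polynomial.eval_zero] at this
  rcases mul_eq_zero.1 this.symm with h | h
  · exact absurd h (pow_ne_zero _ hδ)
  · exact h

/-- The representation attached to a module with basis. -/
noncomputable def repOf {d : ℕ} (c : Basis (Fin d) K M) : Λ →ₐ[K] Matrix (Fin d) (Fin d) K :=
  (LinearMap.toMatrixAlgEquiv c).toAlgHom.comp (Algebra.lsmul K K M : Λ →ₐ[K] Module.End K M)

lemma repOf_apply {d : ℕ} (c : Basis (Fin d) K M) (a : Λ) (i j : Fin d) :
    repOf c a i j = c.repr (a • c j) i := by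
  simp [repOf, LinearMap.toMatrixAlgEquiv_apply]

lemma repSpace_smul {d : ℕ} (ρ : Λ →ₐ[K] Matrix (Fin d) (Fin d) K) (a : Λ)
    (v : RepSpace K d ρ) : a • v = (ρ a).mulVec v := rfl

lemma repOf_mulVec {d : ℕ} (c : Basis (Fin d) K M) (a : Λ) (m : M) :
    (repOf c a).mulVec (c.equivFun m) = c.equivFun (a • m) := by
  have := LinearMap.toMatrix_mulVec_repr c c (Algebra.lsmul K K M a) m
  exact this

lemma repOf_equiv {d : ℕ} (c : Basis (Fin d) K M) :
    Nonempty (RepSpace K d (repOf (Λ := Λ) c) ≃ₗ[Λ] M) :=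
  ⟨LinearEquiv.symm
    { toFun := fun m => (c.equivFun m : RepSpace K d (repOf (Λ := Λ) c))
      invFun := fun v => c.equivFun.symm v
      left_inv := fun m => by simp
      right_inv := fun v => c.equivFun.apply_symm_apply v
      map_add' := fun x y => map_add c.equivFun x y
      map_smul' := fun a m => (repOf_mulVec c a m).symm }⟩

lemma rep_conj {d : ℕ} (ρ : Λ →ₐ[K] Matrix (Fin d) (Fin d) K)
    (e : RepSpace K d ρ ≃ₗ[Λ] M) (c : Basis (Fin d) K M) :
    ∃ g : GL (Fin d) K, ∀ a, repOf c a =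
      (g : Matrix (Fin d) (Fin d) K) * ρ a * ((g⁻¹ : GL (Fin d) K) : Matrix (Fin d) (Fin d) K) := by
  let f : (Fin d → K) ≃ₗ[K] (Fin d → K) := (e.restrictScalars K).trans c.equivFun
  have hf : ∀ v : Fin d → K, f v = c.equivFun (e v) := fun v => rfl
  let G : Matrix (Fin d) (Fin d) K := LinearMap.toMatrix' f.toLinearMap
  let G' : Matrix (Fin d) (Fin d) K := LinearMap.toMatrix' f.symm.toLinearMap
  have h1 : G * G' = 1 := by
    rw [← LinearMap.toMatrix'_comp]; simp
  have h2 : G' * G = 1 := by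
    rw [← LinearMap.toMatrix'_comp]; simp
  refine ⟨⟨G, G', h1, h2⟩, fun a => ?_⟩
  change repOf c a = G * ρ a * G'
  have h3 : repOf c a * G = G * ρ a := by
    apply Matrix.toLin'.injective
    ext1 v
    apply LinearMap.ext
    intro k
    simp only [LinearMap.comp_apply]
    generalize (LinearMap.single K (fun _ => K) v) k = v
    rw [Matrix.toLin'_mul, Matrix.toLin'_mul]
    simp only [LinearMap.comp_apply, G, Matrix.toLin'_toMatrix']
    simp only [LinearEquiv.coe_coe, hf, Matrix.toLin'_apply]
    rw [repOf_mulVec]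
    exact congrArg c.equivFun (e.map_smul a (v : RepSpace K d ρ)).symm
  rw [← h3, mul_assoc, h1, mul_one]

/-- polynomial curves in a vector space -/
def IsPV (v : K → Y) : Prop :=
  ∀ l : Y →ₗ[K] K, ∃ p : Polynomial K, ∀ s, l (v s) = p.eval s

lemma IsPV.const (y : Y) : IsPV (K := K) (fun _ => y) := fun l => ⟨Polynomial.C (l y), by simp⟩

lemma IsPV.add {v w : K → Y} (hv : IsPV v) (hw : IsPV w) : IsPV (fun s => v s + w s) := by
  intro l
  obtain ⟨p, hp⟩ := hv l
  obtain ⟨q, hq⟩ := hw l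
  exact ⟨p + q, fun s => by simp [hp, hq]⟩

lemma IsPV.smul {v : K → Y} (hv : IsPV v) {f : K → K} (hf : ∃ q : Polynomial K, ∀ s, f s = q.eval s) :
    IsPV (fun s => f s • v s) := by
  intro l
  obtain ⟨p, hp⟩ := hv l
  obtain ⟨q, hq⟩ := hf
  exact ⟨q * p, fun s => by simp [hp, hq]⟩

lemma IsPV.sum {ι : Type} (I : Finset ι) {v : ι → K → Y} (hv : ∀ i, IsPV (v i)) :
    IsPV (fun s => ∑ i ∈ I, v i s) := by
  intro l
  choose p hp using fun i => hv i l
  exact ⟨∑ i ∈ I, p i, fun s => by simp [hp, Polynomial.eval_finsetSum]⟩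

lemma IsPV.map {v : K → Y} (hv : IsPV v) (f : Y →ₗ[K] N) : IsPV (fun s => f (v s)) :=
  fun l => hv (l.comp f)

lemma degen [Infinite K] [FiniteDimensional K Y] [FiniteDimensional K N] [FiniteDimensional K M]
    {ι : Type} [Fintype ι]
    (b : Basis ι K Λ) {d : ℕ} (q0 : Y →ₗ[Λ] N) (hq0 : Function.Surjective q0) (σ : Y →ₗ[K] Y)
    (H : ∀ s : K, s ≠ 0 → ∃ q : Y →ₗ[Λ] M, Function.Surjective q ∧
      ∀ x, q0 x = 0 → q (x + s • σ x) = 0)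
    (hN : finrank K N = d) (hM : finrank K M = d)
    (ρ : Λ →ₐ[K] Matrix (Fin d) (Fin d) K) (e : RepSpace K d ρ ≃ₗ[Λ] M) :
    ∃ τ : Λ →ₐ[K] Matrix (Fin d) (Fin d) K,
      Nonempty (RepSpace K d τ ≃ₗ[Λ] N) ∧ IsDegeneration b d ρ τ := by
  classical
  let c : Basis (Fin d) K N := Module.finBasisOfFinrankEq K N hN
  let y := Module.finBasis K Y
  choose w hw using fun j => hq0 (c j)
  refine ⟨repOf c, repOf_equiv c, ?_⟩
  let S := LinearMap.toMatrix y y σ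
  let Θ : Matrix _ _ (Polynomial K) := 1 + (Polynomial.X : Polynomial K) • S.map Polynomial.C
  have hΘ : ∀ s, Θ.map (Polynomial.eval s) = LinearMap.toMatrix y y (LinearMap.id + s • σ : Y →ₗ[K] Y) := by
    intro s
    rw [map_add, map_smul, LinearMap.toMatrix_id]
    ext i j
    simp [Θ, Matrix.one_apply, S]
    split_ifs <;> simp [mul_comm]
  let δ := Θ.det
  have hδ : ∀ s, δ.eval s = (LinearMap.toMatrix y y (LinearMap.id + s • σ : Y →ₗ[K] Y)).det := by
    intro s
    rw [← hΘ]
    exact RingHom.map_det (Polynomial.evalRingHom s) Θ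
  have hadj : ∀ s, Θ.adjugate.map (Polynomial.eval s) =
      (LinearMap.toMatrix y y (LinearMap.id + s • σ : Y →ₗ[K] Y)).adjugate := by
    intro s
    rw [← hΘ]
    exact RingHom.map_adjugate (Polynomial.evalRingHom s) Θ
  let ω : K → (Y →ₗ[K] Y) := fun s =>
    Matrix.toLin y y (LinearMap.toMatrix y y (LinearMap.id + s • σ : Y →ₗ[K] Y)).adjugate
  have hω : ∀ s v, (LinearMap.id + s • σ : Y →ₗ[K] Y) (ω s v) = δ.eval s • v := by
    intro s v
    have h1 : (LinearMap.id + s • σ : Y →ₗ[K] Y) = Matrix.toLin y y (LinearMap.toMatrix y y (LinearMap.id + s • σ : Y →ₗ[K] Y)) := by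
      simp
    have h2 : (LinearMap.id + s • σ : Y →ₗ[K] Y).comp (ω s) = δ.eval s • LinearMap.id := by
      conv_lhs => rw [h1]
      rw [← Matrix.toLin_mul, Matrix.mul_adjugate, hδ, map_smul, Matrix.toLin_one]
    exact LinearMap.congr_fun h2 v
  have hωPV : ∀ v : K → Y, IsPV v → IsPV (fun s => ω s (v s)) := by
    intro v hv
    have : (fun s => ω s (v s)) = fun s => ∑ i, (∑ j, (Θ.adjugate i j).eval s • (y.coord j (v s))) • y i := by
      funext s
      simp only [ω, Matrix.toLin_apply, Matrix.mulVec, dotProduct, ← hadj, Matrix.map_apply,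
        Basis.coord_apply, smul_eq_mul]
    rw [this]
    refine IsPV.sum _ fun i => IsPV.smul (IsPV.const _) ?_
    have h3 : IsPV (Y := K) (fun s : K => ∑ j, (Θ.adjugate i j).eval s • (y.coord j (v s))) :=
      IsPV.sum _ fun j => IsPV.smul (hv.map (y.coord j)) ⟨_, fun s => rfl⟩
    exact h3 LinearMap.id
  have hpoly : ∀ x : ι × Fin d × Fin d, ∃ p : Polynomial K, ∀ s,
      c.coord x.2.1 (q0 (ω s (b x.1 • ((LinearMap.id + s • σ : Y →ₗ[K] Y) (w x.2.2))))) = p.eval s := by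
    intro x
    have h1 : IsPV (fun s : K => (LinearMap.id + s • σ : Y →ₗ[K] Y) (w x.2.2)) := by
      simp only [LinearMap.add_apply, LinearMap.smul_apply]
      exact (IsPV.const _).add ((IsPV.const _).smul ⟨Polynomial.X, by simp⟩)
    have h2 := hωPV _ (h1.map (Algebra.lsmul K K Y (b x.1)))
    exact h2 ((c.coord x.2.1).comp (q0.restrictScalars K))
  choose f hf using hpoly
  intro p hp
  have hδ0 : δ.eval 0 = 1 := by
    rw [hδ]; simp
  have hω0 : ∀ v, ω 0 v = v := by
    intro v
    have := hω 0 v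
    rw [hδ0] at this
    simpa using this
  have key := eval_zero_of p f δ (by rw [hδ0]; exact one_ne_zero) ?_
  · convert key using 3
    funext x
    rw [← hf, hδ0, hω0, repOf_apply]
    simp [hw]
  · intro s hs hs'
    obtain ⟨q, hq, hqk⟩ := H s hs
    let θ : Y →ₗ[K] Y := LinearMap.id + s • σ
    have hθs : Function.Surjective θ := fun v => ⟨(δ.eval s)⁻¹ • ω s v, by
      rw [map_smul]; change _ • (LinearMap.id + s • σ : Y →ₗ[K] Y) (ω s v) = v
      rw [hω, smul_smul, inv_mul_cancel₀ hs', one_smul]⟩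
    let qθ : Y →ₗ[K] M := (q.restrictScalars K).comp θ
    let q0K : Y →ₗ[K] N := q0.restrictScalars K
    have hker : LinearMap.ker q0K ≤ LinearMap.ker qθ := fun x hx => hqk x hx
    let φ : N →ₗ[K] M := ((LinearMap.ker q0K).liftQ qθ hker).comp
      (q0K.quotKerEquivOfSurjective hq0).symm.toLinearMap
    have hφ : ∀ v, φ (q0 v) = q (θ v) := by
      intro v
      have : (q0K.quotKerEquivOfSurjective hq0).symm (q0 v) = Submodule.Quotient.mk v := by
        rw [LinearEquiv.symm_apply_eq]; rfl
      simp only [φ, LinearMap.comp_apply, LinearEquiv.coe_coe, this]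
      rfl
    have hφs : Function.Surjective φ := by
      intro m
      obtain ⟨v, rfl⟩ := hq m
      obtain ⟨u, rfl⟩ := hθs v
      exact ⟨q0 u, hφ u⟩
    have hφb : Function.Bijective φ :=
      ⟨(LinearMap.injective_iff_surjective_of_finrank_eq_finrank (hN.trans hM.symm)).2 hφs, hφs⟩
    let φe := LinearEquiv.ofBijective φ hφb
    obtain ⟨g, hg⟩ := rep_conj ρ e (c.map φe)
    have := hp g
    simp only [← hg] at this
    convert this using 3
    funext x
    rw [repOf_apply, ← hf]
    have hz : b x.1 • (c.map φe) x.2.2 =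
        φe (q0 ((δ.eval s)⁻¹ • ω s (b x.1 • θ (w x.2.2)))) := by
      change _ = φ _
      rw [hφ, map_smul θ]
      change _ = q (_ • ((LinearMap.id + s • σ : Y →ₗ[K] Y) (ω s _)))
      rw [hω, smul_smul, inv_mul_cancel₀ hs', one_smul, map_smul, ← hφ, hw]
      rfl
    rw [hz]
    have hK : ∀ (k : K) (v : Y), q0 (k • v) = k • q0 v := fun k v => map_smul q0K k v
    simp [Basis.map_repr, hK, θ, mul_add]

end PartB

section PartC
set_option linter.unusedSectionVars false

variable {K Λ : Type} [Field K] [Ring Λ] [Algebra K Λ]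
variable {T P X Z S : Type}
  [AddCommGroup T] [Module Λ T] [Module K T] [IsScalarTower K Λ T]
  [AddCommGroup P] [Module Λ P] [Module K P] [IsScalarTower K Λ P]
  [AddCommGroup X] [Module Λ X] [Module K X] [IsScalarTower K Λ X]
  [AddCommGroup Z] [Module Λ Z] [Module K Z] [IsScalarTower K Λ Z]
  [AddCommGroup S] [Module Λ S] [Module K S] [IsScalarTower K Λ S]

lemma hom_finite [FiniteDimensional K P] [FiniteDimensional K X] :
    FiniteDimensional K (P →ₗ[Λ] X) :=
  .of_injective (LinearMap.restrictScalarsₗ K Λ P X K) (LinearMap.restrictScalars_injective _)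

lemma fd_sub [FiniteDimensional K X] (Y : Submodule Λ X) : FiniteDimensional K Y :=
  .of_injective (Y.subtype.restrictScalars K) Y.injective_subtype

lemma fd_quot [FiniteDimensional K X] (Y : Submodule Λ X) : FiniteDimensional K (X ⧸ Y) :=
  .of_surjective (Y.mkQ.restrictScalars K) Y.mkQ_surjective

/-- Postcomposition as a `K`-linear map. -/
def postc (P : Type) [AddCommGroup P] [Module Λ P] (g : X →ₗ[Λ] Z) :
    (P →ₗ[Λ] X) →ₗ[K] (P →ₗ[Λ] Z) where
  toFun f := g.comp f
  map_add' f f' := by ext x; simp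
  map_smul' k f := by
    ext x
    simp only [LinearMap.comp_apply, LinearMap.smul_apply, RingHom.id_apply]
    exact LinearMap.map_smul_of_tower g k (f x)

/-- Precomposition as a `K`-linear map. -/
def prec (X : Type) [AddCommGroup X] [Module Λ X] [Module K X] [IsScalarTower K Λ X]
    (g : P →ₗ[Λ] Z) :
    (Z →ₗ[Λ] X) →ₗ[K] (P →ₗ[Λ] X) where
  toFun f := f.comp g
  map_add' f f' := by ext x; simp
  map_smul' k f := by ext x; simp

lemma finrank_hom_congr (e : X ≃ₗ[Λ] Z) :
    finrank K (P →ₗ[Λ] X) = finrank K (P →ₗ[Λ] Z) := by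
  refine LinearEquiv.finrank_eq (LinearEquiv.ofLinearMap (postc P e.toLinearMap)
    (postc P e.symm.toLinearMap) ?_ ?_) <;>
  · ext f x; simp [postc]

lemma finrank_hom_add [FiniteDimensional K P] [FiniteDimensional K X]
    [Module.Projective Λ P] (Y : Submodule Λ X) :
    finrank K (P →ₗ[Λ] X) = finrank K (P →ₗ[Λ] Y) + finrank K (P →ₗ[Λ] X ⧸ Y) := by
  have := hom_finite (K := K) (Λ := Λ) (P := P) (X := X)
  have hs : Function.Surjective (postc (K := K) P Y.mkQ) := fun g => by
    obtain ⟨h, hh⟩ := Module.projective_lifting_property Y.mkQ g Y.mkQ_surjective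
    exact ⟨h, hh⟩
  have h1 := LinearMap.finrank_range_add_finrank_ker (postc (K := K) P Y.mkQ)
  rw [LinearMap.range_eq_top.2 hs, finrank_top] at h1
  have hi : Function.Injective (postc (K := K) P Y.subtype) := fun f g h => by
    ext x
    exact LinearMap.congr_fun h x
  have h2 := LinearMap.finrank_range_of_inj hi
  have h3 : LinearMap.range (postc (K := K) P Y.subtype) = LinearMap.ker (postc (K := K) P Y.mkQ) := by
    ext f
    constructor
    · rintro ⟨g, rfl⟩
      rw [LinearMap.mem_ker]
      ext x
      simp [postc]
    · intro hf
      refine ⟨f.codRestrict Y fun x => ?_, ?_⟩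
      · have := LinearMap.congr_fun (LinearMap.mem_ker.1 hf) x
        simpa [postc] using this
      · ext x; rfl
  rw [h3] at h2
  omega

/-- Squarefree. -/
def SqF (Λ T : Type) [Ring Λ] [AddCommGroup T] [Module Λ T] : Prop :=
  ∀ S S' : Submodule Λ T, IsSimpleModule Λ ↥S → IsSimpleModule Λ ↥S' →
        Nonempty (↥S ≃ₗ[Λ] ↥S') → S = S'

lemma prop_T [IsAlgClosed K] [FiniteDimensional K S] [IsSimpleModule Λ S] (hss : IsSemisimpleModule Λ T)
    (hsf : SqF Λ T) (a b : T →ₗ[Λ] S) (hb : b ≠ 0) : ∃ k : K, a = k • b := by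
  obtain ⟨s, hs⟩ := IsSemisimpleModule.lifting_property b (LinearMap.surjective_of_ne_zero hb)
    LinearMap.id
  have hs' : ∀ x, b (s x) = x := fun x => LinearMap.congr_fun hs x
  have hk : ∀ x, b x = 0 → a x = 0 := by
    by_contra hcon
    push Not at hcon
    obtain ⟨x, hx, hax⟩ := hcon
    let a' := a.comp (LinearMap.ker b).subtype
    have ha' : a' ≠ 0 := fun h => hax (LinearMap.congr_fun h ⟨x, hx⟩)
    obtain ⟨r, hr⟩ := IsSemisimpleModule.lifting_property a' (LinearMap.surjective_of_ne_zero ha')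
      LinearMap.id
    have hr' : ∀ x, a (r x : T) = x := fun x => LinearMap.congr_fun hr x
    let r' := (LinearMap.ker b).subtype.comp r
    have hri : Function.Injective r' := fun u v h => by
      have := congrArg a h
      exact (hr' u).symm.trans (this.trans (hr' v))
    have hsi : Function.Injective s := fun u v h => by
      have := congrArg b h
      exact (hs' u).symm.trans (this.trans (hs' v))
    let e1 := LinearEquiv.ofInjective r' hri
    let e2 := LinearEquiv.ofInjective s hsi
    have heq : LinearMap.range r' = LinearMap.range s :=
      hsf _ _ (IsSimpleModule.congr e1.symm) (IsSimpleModule.congr e2.symm) ⟨e1.symm.trans e2⟩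
    have : Nontrivial S := IsSimpleModule.nontrivial Λ S
    obtain ⟨z, hz⟩ := exists_ne (0 : S)
    have hmem : s z ∈ LinearMap.range r' := by rw [heq]; exact ⟨z, rfl⟩
    obtain ⟨u, hu⟩ := hmem
    apply hz
    rw [← hs' z, ← hu]
    exact (r u).2
  obtain ⟨k, hk'⟩ := (IsSimpleModule.algebraMap_end_bijective_of_isAlgClosed (A := Λ) (V := S) K).2
    (a.comp s)
  refine ⟨k, ?_⟩
  ext x
  have h1 := hk (x - s (b x)) (by rw [map_sub, hs', sub_self])
  rw [map_sub, sub_eq_zero] at h1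
  rw [h1]
  exact (LinearMap.congr_fun hk' (b x)).symm

lemma factor_T [IsSimpleModule Λ S] (E : (P ⧸ jrad Λ P) ≃ₗ[Λ] T) (a : P →ₗ[Λ] S) :
    ∃ a' : T →ₗ[Λ] S, a = a'.comp (E.toLinearMap.comp (jrad Λ P).mkQ) := by
  refine ⟨((jrad Λ P).liftQ a ?_).comp E.symm.toLinearMap, ?_⟩
  · intro x hx
    have := jrad_apply a hx
    rwa [jrad_semisimple] at this
  · ext x; simp; rfl

lemma prop_P [IsAlgClosed K] [FiniteDimensional K S] [IsSimpleModule Λ S] (hss : IsSemisimpleModule Λ T)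
    (hsf : SqF Λ T) (E : (P ⧸ jrad Λ P) ≃ₗ[Λ] T) (a b : P →ₗ[Λ] S) (hb : b ≠ 0) :
    ∃ k : K, a = k • b := by
  obtain ⟨a', rfl⟩ := factor_T E a
  obtain ⟨b', rfl⟩ := factor_T E b
  obtain ⟨k, rfl⟩ := prop_T (K := K) hss hsf a' b' (by rintro rfl; exact hb (by ext; simp))
  exact ⟨k, by ext; simp⟩

lemma finrank_one [IsAlgClosed K] [FiniteDimensional K S] [IsSimpleModule Λ S] (hss : IsSemisimpleModule Λ T)
    (hsf : SqF Λ T) (E : (P ⧸ jrad Λ P) ≃ₗ[Λ] T) 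
    (h : ∃ S' : Submodule Λ T, IsSimpleModule Λ S' ∧ Nonempty (S ≃ₗ[Λ] S')) :
    finrank K (P →ₗ[Λ] S) = 1 := by
  obtain ⟨S', hS', ⟨e⟩⟩ := h
  obtain ⟨r, hr⟩ := IsSemisimpleModule.extension_property S'.subtype S'.injective_subtype
    e.symm.toLinearMap
  have hrs : Function.Surjective r := fun x => ⟨e x, by
    have := LinearMap.congr_fun hr (e x)
    simpa using this⟩
  have : Nontrivial S := IsSimpleModule.nontrivial Λ S
  refine finrank_eq_one (r.comp (E.toLinearMap.comp (jrad Λ P).mkQ)) ?_ ?_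
  · intro h
    obtain ⟨z, hz⟩ := exists_ne (0 : S)
    obtain ⟨y, hy⟩ := (hrs.comp (E.surjective.comp (jrad Λ P).mkQ_surjective)) z
    exact hz (hy.symm.trans (LinearMap.congr_fun h y))
  · intro a
    obtain ⟨k, hk⟩ := prop_P (K := K) hss hsf E a (r.comp (E.toLinearMap.comp (jrad Λ P).mkQ)) (by
      intro h
      obtain ⟨z, hz⟩ := exists_ne (0 : S)
      obtain ⟨y, hy⟩ := (hrs.comp (E.surjective.comp (jrad Λ P).mkQ_surjective)) z
      exact hz (hy.symm.trans (LinearMap.congr_fun h y)))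
    exact ⟨k, hk.symm⟩

lemma finrank_zero [IsSimpleModule Λ S] (hss : IsSemisimpleModule Λ T)
    (E : (P ⧸ jrad Λ P) ≃ₗ[Λ] T) 
    (h : ¬ ∃ S' : Submodule Λ T, IsSimpleModule Λ S' ∧ Nonempty (S ≃ₗ[Λ] S')) :
    finrank K (P →ₗ[Λ] S) = 0 := by
  have h0 : ∀ a : P →ₗ[Λ] S, a = 0 := by
    intro a
    by_contra ha
    obtain ⟨a', rfl⟩ := factor_T E a
    have ha' : a' ≠ 0 := by rintro rfl; exact ha (by ext; simp)
    obtain ⟨s, hs⟩ := IsSemisimpleModule.lifting_property a' (LinearMap.surjective_of_ne_zero ha')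
      LinearMap.id
    have hs' : ∀ x, a' (s x) = x := fun x => LinearMap.congr_fun hs x
    have hsi : Function.Injective s := fun u v h => by
      have := congrArg a' h
      exact (hs' u).symm.trans (this.trans (hs' v))
    let e2 := LinearEquiv.ofInjective s hsi
    exact h ⟨_, IsSimpleModule.congr e2.symm, ⟨e2⟩⟩
  have : Subsingleton (P →ₗ[Λ] S) := ⟨fun a b => (h0 a).trans (h0 b).symm⟩
  exact Module.finrank_zero_of_subsingleton

lemma telescope (n : ℕ) (F : Fin (n + 1) → ℕ) (g : Fin n → ℕ)
    (h : ∀ i : Fin n, F i.succ = F i.castSucc + g i) : F (Fin.last n) = F 0 + ∑ i, g i := by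
  induction n with
  | zero => simp
  | succ n ih =>
    have := ih (fun i => F i.castSucc) (fun i => g i.castSucc) (fun i => h i.castSucc)
    rw [Fin.sum_univ_castSucc, ← Fin.succ_last, h (Fin.last n)]
    simp only [Fin.castSucc_zero] at this
    omega

lemma count [IsAlgClosed K] [FiniteDimensional K P] [FiniteDimensional K X]
    [Module.Projective Λ P] (hss : IsSemisimpleModule Λ T)
    (hsf : SqF Λ T) (E : (P ⧸ jrad Λ P) ≃ₗ[Λ] T)
    (s : CompositionSeries (Submodule Λ X)) (h0 : s.head = ⊥) (h1 : s.last = ⊤) :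
    Nat.card {i : Fin s.length //
            ∃ S : Submodule Λ T, IsSimpleModule Λ ↥S ∧
              Nonempty ((↥(s.toFun i.succ) ⧸
                Submodule.comap (s.toFun i.succ).subtype (s.toFun i.castSucc)) ≃ₗ[Λ] ↥S)} =
      finrank K (P →ₗ[Λ] X) := by
  classical
  have ht := telescope s.length (fun i => finrank K (P →ₗ[Λ] (s.toFun i)))
    (fun i => if ∃ S : Submodule Λ T, IsSimpleModule Λ ↥S ∧
              Nonempty ((↥(s.toFun i.succ) ⧸
                Submodule.comap (s.toFun i.succ).subtype (s.toFun i.castSucc)) ≃ₗ[Λ] ↥S)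
       then 1 else 0) ?_
  · have e0 : finrank K (P →ₗ[Λ] (s.toFun 0)) = 0 := by
      have : s.toFun 0 = ⊥ := h0
      rw [this]
      exact Module.finrank_zero_of_subsingleton
    have e1 : finrank K (P →ₗ[Λ] (s.toFun (Fin.last _))) = finrank K (P →ₗ[Λ] X) := by
      have : s.toFun (Fin.last _) = ⊤ := h1
      rw [this]
      exact finrank_hom_congr Submodule.topEquiv
    rw [← e1, ht, e0, zero_add, Nat.card_eq_fintype_card, Fintype.card_subtype, Finset.card_filter]
  · intro i
    have hc : s.toFun i.castSucc ⋖ s.toFun i.succ := s.step i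
    have := fd_sub (K := K) (s.toFun i.succ)
    have := fd_quot (K := K) (Submodule.comap (s.toFun i.succ).subtype (s.toFun i.castSucc))
    have hsimp := (covBy_iff_quot_is_simple hc.le).1 hc
    simp only
    rw [finrank_hom_add (K := K) (P := P) (Submodule.comap (s.toFun i.succ).subtype (s.toFun i.castSucc)),
      finrank_hom_congr (K := K) (P := P) (Submodule.comapSubtypeEquivOfLe hc.le)]
    congr 1
    split_ifs with hh
    · exact finrank_one hss hsf E hh
    · exact finrank_zero hss E hh

lemma finrank_hom_T [IsAlgClosed K] [FiniteDimensional K P] [FiniteDimensional K T]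
    (hss : IsSemisimpleModule Λ T)
    (hsf : SqF Λ T) (E : (P ⧸ jrad Λ P) ≃ₗ[Λ] T) :
    finrank K (P →ₗ[Λ] T) = Nat.card {S : Submodule Λ T // IsSimpleModule Λ ↥S} := by
  classical
  have : Module.Finite Λ T := Module.Finite.of_restrictScalars_finite K Λ T
  obtain ⟨n, S, e, hS⟩ := IsSemisimpleModule.exists_linearEquiv_fin_dfinsupp Λ T
  let e' : T ≃ₗ[Λ] (∀ i, S i) := e.trans DFinsupp.linearEquivFunOnFintype
  have h1 : finrank K (P →ₗ[Λ] T) = n := by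
    have hf' : ∀ i, FiniteDimensional K (S i) := fun i => fd_sub (S i)
    have hf : ∀ i, FiniteDimensional K (P →ₗ[Λ] S i) := fun i => hom_finite
    have hone : ∀ i, finrank K (P →ₗ[Λ] S i) = 1 := fun i => have := hS i
      finrank_one hss hsf E ⟨S i, hS i, ⟨LinearEquiv.refl _ _⟩⟩
    have L : (∀ i, P →ₗ[Λ] S i) ≃ₗ[K] (P →ₗ[Λ] (∀ i, S i)) :=
      { toFun := fun f => LinearMap.pi f
        invFun := fun f i => (LinearMap.proj i).comp f
        left_inv := fun f => by ext; simp
        right_inv := fun f => by ext; simp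
        map_add' := fun f g => by ext; simp
        map_smul' := fun k f => by ext; simp }
    rw [finrank_hom_congr e', ← L.finrank_eq, Module.finrank_pi_fintype]
    simp [hone]
  rw [h1]
  let ι : ∀ i, S i →ₗ[Λ] T := fun i => e'.symm.toLinearMap.comp (LinearMap.single Λ (fun i => S i) i)
  have hι : ∀ i, Function.Injective (ι i) := fun i =>
    e'.symm.injective.comp (Pi.single_injective (M := fun i => S i) i)
  let S' : Fin n → {S : Submodule Λ T // IsSimpleModule Λ ↥S} := fun i =>
    ⟨LinearMap.range (ι i), by
      have := hS i
      exact IsSimpleModule.congr (LinearEquiv.ofInjective (ι i) (hι i)).symm⟩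
  have hb : Function.Bijective S' := by
    constructor
    · intro i j hij
      by_contra hne
      have := hS i
      have : Nontrivial (S i) := IsSimpleModule.nontrivial Λ (S i)
      obtain ⟨z, hz⟩ := exists_ne (0 : S i)
      have hm : ι i z ∈ (S' j).1 := by rw [← hij]; exact ⟨z, rfl⟩
      obtain ⟨w, hw⟩ := hm
      have := e'.symm.injective hw
      have := congrFun this i
      simp [hne] at this
      exact hz this.symm
    · rintro ⟨W, hW⟩
      have hne : ∃ i, ((LinearMap.proj i).comp e'.toLinearMap).comp W.subtype ≠
          (0 : W →ₗ[Λ] S i) := by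
        by_contra hcon
        push Not at hcon
        have : Nontrivial W := IsSimpleModule.nontrivial Λ W
        obtain ⟨z, hz⟩ := exists_ne (0 : W)
        apply hz
        apply W.injective_subtype
        apply e'.injective
        funext i
        have := LinearMap.congr_fun (hcon i) z
        simpa using this
      obtain ⟨i, hi⟩ := hne
      have := hS i
      refine ⟨i, Subtype.ext (hsf _ _ (S' i).2 hW ⟨?_⟩)⟩
      exact (LinearEquiv.ofInjective (ι i) (hι i)).symm.trans
        (LinearEquiv.ofBijective _ (LinearMap.bijective_of_ne_zero hi)).symm
  rw [← Nat.card_congr (Equiv.ofBijective S' hb)]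
  simp

end PartC

section PartD
set_option linter.unusedSectionVars false

variable {K Λ : Type} [Field K] [Ring Λ] [Algebra K Λ]
variable {T P : Type}
  [AddCommGroup T] [Module Λ T] [Module K T] [IsScalarTower K Λ T]
  [AddCommGroup P] [Module Λ P] [Module K P] [IsScalarTower K Λ P]

lemma prec_iff {X Z : Type} [AddCommGroup X] [Module Λ X] [Module K X] [IsScalarTower K Λ X]
    [AddCommGroup Z] [Module Λ Z] [Module K Z] [IsScalarTower K Λ Z]
    [FiniteDimensional K P] [FiniteDimensional K X] (g : P →ₗ[Λ] Z) (hg : Function.Surjective g) :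
    finrank K (Z →ₗ[Λ] X) = finrank K (P →ₗ[Λ] X) ↔ ∀ f : P →ₗ[Λ] X, ∀ c, g c = 0 → f c = 0 := by
  have : FiniteDimensional K Z := .of_surjective (g.restrictScalars K) hg
  have hfd1 := hom_finite (K := K) (Λ := Λ) (P := P) (X := X)
  have hfd2 := hom_finite (K := K) (Λ := Λ) (P := Z) (X := X)
  let pc := prec (K := K) X g
  have hpi : Function.Injective pc := fun f f' h => by
    ext z
    obtain ⟨y, rfl⟩ := hg z
    exact LinearMap.congr_fun h y
  constructor
  · intro h f c hc
    have hsur : Function.Surjective pc := by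
      apply LinearMap.range_eq_top.1
      apply Submodule.eq_top_of_finrank_eq
      rw [← h]
      exact LinearMap.finrank_range_of_inj hpi
    obtain ⟨u, rfl⟩ := hsur f
    change u (g c) = 0
    rw [hc, map_zero]
  · intro h
    refine LinearEquiv.finrank_eq (LinearEquiv.ofBijective pc ⟨hpi, fun f => ?_⟩)
    refine ⟨((LinearMap.ker g).liftQ f (fun c hc => h f c hc)).comp
      (g.quotKerEquivOfSurjective hg).symm.toLinearMap, ?_⟩
    ext x
    have : (g.quotKerEquivOfSurjective hg).symm (g x) = Submodule.Quotient.mk x := by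
      rw [LinearEquiv.symm_apply_eq]; rfl
    change ((LinearMap.ker g).liftQ f (fun c hc => h f c hc)) ((g.quotKerEquivOfSurjective hg).symm (g x)) = f x
    rw [this]
    rfl

lemma mu_iff [IsAlgClosed K] [FiniteDimensional K Λ] [FiniteDimensional K T] [FiniteDimensional K P]
    (hss : IsSemisimpleModule Λ T) (hsf : SqF Λ T)
    (t : ℕ) (ht : Nat.card {S : Submodule Λ T // IsSimpleModule Λ ↥S} = t)
    (hproj : Module.Projective Λ P) (E : (P ⧸ jrad Λ P) ≃ₗ[Λ] T)
    (C : Submodule Λ P) (hC : C ≤ jrad Λ P) :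
    (∀ s : CompositionSeries (Submodule Λ (P ⧸ C)), s.head = ⊥ → s.last = ⊤ →
        Nat.card {i : Fin s.length //
            ∃ S : Submodule Λ T, IsSimpleModule Λ ↥S ∧
              Nonempty ((↥(s.toFun i.succ) ⧸
                Submodule.comap (s.toFun i.succ).subtype (s.toFun i.castSucc)) ≃ₗ[Λ] ↥S)} =
          t + finrank K ((P ⧸ C) →ₗ[Λ] ↥(jrad Λ (P ⧸ C)))) ↔
    ∀ f : P →ₗ[Λ] jrad Λ (P ⧸ C), ∀ c ∈ C, f c = 0 := by
  have := fd_quot (K := K) C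
  have := fd_sub (K := K) (jrad Λ (P ⧸ C))
  have h1 := finrank_hom_add (K := K) (P := P) (jrad Λ (P ⧸ C))
  obtain ⟨e⟩ := top_equiv_of_ker_le C.mkQ C.mkQ_surjective (by simpa using hC)
  rw [finrank_hom_congr (e.trans E), finrank_hom_T hss hsf E, ht] at h1
  have hA : IsArtinianRing Λ := isArtinian_of_tower K inferInstance
  have hF : Module.Finite Λ (P ⧸ C) := Module.Finite.of_restrictScalars_finite K Λ _
  obtain ⟨s0, hs0, hs0'⟩ := exists_compositionSeries_of_isNoetherian_isArtinian Λ (P ⧸ C)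
  trans finrank K ((P ⧸ C) →ₗ[Λ] ↥(jrad Λ (P ⧸ C))) = finrank K (P →ₗ[Λ] ↥(jrad Λ (P ⧸ C)))
  · constructor
    · intro h
      have h2 := h s0 hs0 hs0'
      rw [count (K := K) hss hsf E s0 hs0 hs0'] at h2
      omega
    · intro h s hs hs'
      rw [count (K := K) hss hsf E s hs hs']
      omega
  · have := prec_iff (K := K) (X := jrad Λ (P ⧸ C)) C.mkQ C.mkQ_surjective
    simp only [Submodule.mkQ_apply, Submodule.Quotient.mk_eq_zero] at this
    exact this

lemma all_kill [IsAlgClosed K] [FiniteDimensional K P]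
    (hss : IsSemisimpleModule Λ T) (hsf : SqF Λ T)
    (E : (P ⧸ jrad Λ P) ≃ₗ[Λ] T)
    (C : Submodule Λ P) 
    (H : ∀ f : P →ₗ[Λ] jrad Λ (P ⧸ C), ∀ c ∈ C, f c = 0)
    {m : ℕ} (Q : Fin m → Submodule Λ (P ⧸ C)) (hQ : iSupIndep Q) (hQ' : (⨆ i, Q i) = ⊤)
    (hloc : ∀ i, IsSimpleModule Λ (Q i ⧸ jrad Λ (Q i)))
    (f : P →ₗ[Λ] P ⧸ C) : ∀ c ∈ C, f c = 0 := by
  classical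
  have hint := DirectSum.isInternal_submodule_of_iSupIndep_of_iSup_eq_top hQ hQ'
  have := fd_quot (K := K) C
  let D : (P ⧸ C) ≃ₗ[Λ] (DirectSum (Fin m) fun i => Q i) :=
    (LinearEquiv.ofBijective (DirectSum.coeLinearMap Q) hint).symm
  let ε : ∀ i, (P ⧸ C) →ₗ[Λ] Q i := fun i => (DirectSum.component Λ (Fin m) (fun i => Q i) i).comp
    D.toLinearMap
  have hεs : ∀ i, Function.Surjective (ε i) := fun i x => by
    refine ⟨D.symm (DirectSum.lof Λ (Fin m) (fun i => Q i) i x), ?_⟩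
    simp [ε, DirectSum.component.lof_self]
  have hεi : ∀ x, (∀ i, ε i x = 0) → x = 0 := by
    intro x hx
    apply D.injective
    rw [map_zero]
    exact DFinsupp.ext hx
  intro c hc
  apply hεi
  intro i
  have := fd_sub (K := K) (Q i)
  have := fd_quot (K := K) (jrad Λ (Q i))
  have := hloc i
  let p : P →ₗ[Λ] Q i := (ε i).comp C.mkQ
  have hps : Function.Surjective ((jrad Λ (Q i)).mkQ.comp p) :=
    (jrad Λ (Q i)).mkQ_surjective.comp ((hεs i).comp C.mkQ_surjective)
  have hp0 : (jrad Λ (Q i)).mkQ.comp p ≠ 0 := by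
    intro h
    have : Nontrivial (Q i ⧸ jrad Λ (Q i)) := IsSimpleModule.nontrivial Λ _
    obtain ⟨z, hz⟩ := exists_ne (0 : Q i ⧸ jrad Λ (Q i))
    obtain ⟨y, hy⟩ := hps z
    exact hz (hy.symm.trans (LinearMap.congr_fun h y))
  obtain ⟨k, hk⟩ := prop_P (K := K) hss hsf E ((jrad Λ (Q i)).mkQ.comp ((ε i).comp f)) _ hp0
  let g : P →ₗ[Λ] Q i := (ε i).comp f - k • p
  have hg : ∀ x, g x ∈ jrad Λ (Q i) := by
    intro x
    have h1 := LinearMap.congr_fun hk x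
    simp only [LinearMap.comp_apply, LinearMap.smul_apply] at h1
    have h2 : (jrad Λ (Q i)).mkQ (k • p x) = k • (jrad Λ (Q i)).mkQ (p x) :=
      LinearMap.map_smul_of_tower _ k _
    rw [← h2, ← sub_eq_zero, ← map_sub] at h1
    rw [← LinearMap.mem_ker, Submodule.ker_mkQ] at h1
    exact h1
  have hg' := H (((Q i).subtype.comp g).codRestrict _ fun x => jrad_apply (Q i).subtype (hg x)) c hc
  have hg0 : g c = 0 := by
    apply (Q i).injective_subtype
    exact congrArg Subtype.val hg'
  have hpc : p c = 0 := by
    have : C.mkQ c = 0 := by simpa using hc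
    change ε i (C.mkQ c) = 0
    rw [this, map_zero]
  have : ε i (f c) - k • p c = 0 := hg0
  rwa [hpc, smul_zero, sub_zero] at this

lemma annih_degen {ι : Type} [Fintype ι] (b : Basis ι K Λ) {d : ℕ}
    (ρ τ : Λ →ₐ[K] Matrix (Fin d) (Fin d) K) (h : IsDegeneration b d ρ τ) (a : Λ)
    (ha : ρ a = 0) : τ a = 0 := by
  have key : ∀ φ : Λ →ₐ[K] Matrix (Fin d) (Fin d) K, ∀ i j,
      φ a i j = ∑ k, b.repr a k * φ (b k) i j := by
    intro φ i j
    conv_lhs => rw [← b.sum_repr a]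
    rw [map_sum, Matrix.sum_apply]
    simp
  ext i j
  have := h (∑ k, MvPolynomial.C (b.repr a k) * MvPolynomial.X (k, i, j)) ?_
  · rw [key τ]
    simpa using this
  · intro g
    simp only [map_sum, map_mul, MvPolynomial.eval_C, MvPolynomial.eval_X]
    have h2 : ∑ k, b.repr a k • ((g : Matrix (Fin d) (Fin d) K) * ρ (b k) *
        ((g⁻¹ : GL (Fin d) K) : Matrix (Fin d) (Fin d) K)) = 0 := by
      have : ∑ k, b.repr a k • ((g : Matrix (Fin d) (Fin d) K) * ρ (b k) *
        ((g⁻¹ : GL (Fin d) K) : Matrix (Fin d) (Fin d) K)) = (g : Matrix (Fin d) (Fin d) K) *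
         (∑ k, b.repr a k • ρ (b k)) * ((g⁻¹ : GL (Fin d) K) : Matrix (Fin d) (Fin d) K) := by
        simp [Finset.mul_sum, Finset.sum_mul]
      rw [this]
      have h3 : ∑ k, b.repr a k • ρ (b k) = ρ a := by
        conv_rhs => rw [← b.sum_repr a, map_sum]
        simp only [map_smul]
      rw [h3, ha]; simp
    have h4 := congrFun (congrFun h2 i) j
    rw [Matrix.sum_apply] at h4
    simpa using h4

lemma rep_zero_iff {d : ℕ} (ρ : Λ →ₐ[K] Matrix (Fin d) (Fin d) K) (a : Λ) :
    ρ a = 0 ↔ ∀ v : RepSpace K d ρ, a • v = 0 := by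
  constructor
  · intro h v
    rw [repSpace_smul, h]
    exact Matrix.zero_mulVec _
  · intro h
    apply Matrix.toLin'.injective
    apply LinearMap.ext
    intro v
    rw [map_zero]
    exact h v

lemma dir2 [IsAlgClosed K] [FiniteDimensional K Λ] [FiniteDimensional K P]
    {ι : Type} [Fintype ι] (b : Basis ι K Λ)
    (hproj : Module.Projective Λ P)
    (C : Submodule Λ P) (hC : C ≤ jrad Λ P)
    (H : ∀ f : P →ₗ[Λ] P ⧸ C, ∀ c ∈ C, f c = 0)
    (d : ℕ) (hd : finrank K (P ⧸ C) = d)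
    (ρ τ : Λ →ₐ[K] Matrix (Fin d) (Fin d) K)
    (e : RepSpace K d ρ ≃ₗ[Λ] (P ⧸ C))
    (hdeg : IsDegeneration b d ρ τ)
    (htop : Nonempty ((RepSpace K d τ ⧸ jrad Λ (RepSpace K d τ)) ≃ₗ[Λ]
          (RepSpace K d ρ ⧸ jrad Λ (RepSpace K d ρ)))) :
    Nonempty (RepSpace K d τ ≃ₗ[Λ] RepSpace K d ρ) := by
  obtain ⟨et⟩ := htop
  have := fd_quot (K := K) C
  have hfdτ : FiniteDimensional K (RepSpace K d τ) :=
    inferInstanceAs (FiniteDimensional K (Fin d → K))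
  have hrk : finrank K (RepSpace K d τ) = d :=
    Module.finrank_fin_fun K
  obtain ⟨φ, hφ⟩ := hproj.out
  have hann : ∀ c ∈ C, ∀ p : P, τ (φ c p) = 0 := by
    intro c hc p
    apply annih_degen b ρ τ hdeg
    rw [rep_zero_iff]
    intro v
    apply e.injective
    rw [map_smul, map_zero]
    exact H ((LinearMap.toSpanSingleton Λ (P ⧸ C) (e v)).comp ((Finsupp.lapply p).comp φ)) c hc
  have hkill : ∀ f : P →ₗ[Λ] RepSpace K d τ, ∀ c ∈ C, f c = 0 := by
    intro f c hc
    have h1 := hφ c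
    rw [← h1, Finsupp.linearCombination_apply, Finsupp.sum, map_sum]
    refine Finset.sum_eq_zero fun p _ => ?_
    rw [map_smul]
    exact (rep_zero_iff τ _).1 (hann c hc p) _
  obtain ⟨e1⟩ := top_equiv_of_ker_le C.mkQ C.mkQ_surjective (by simpa using hC)
  obtain ⟨e2⟩ := top_equiv_of_equiv e
  let E : (P ⧸ jrad Λ P) ≃ₗ[Λ] (RepSpace K d τ ⧸ jrad Λ (RepSpace K d τ)) :=
    (e1.symm.trans e2).trans et.symm
  obtain ⟨f, hf⟩ := Module.projective_lifting_property (jrad Λ (RepSpace K d τ)).mkQ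
    (E.toLinearMap.comp (jrad Λ P).mkQ) (Submodule.mkQ_surjective _)
  have hF : Module.Finite Λ (RepSpace K d τ) := Module.Finite.of_restrictScalars_finite K Λ _
  have hfs : Function.Surjective f := by
    apply nakayama_surj
    rw [eq_top_iff]
    intro y _
    obtain ⟨x, hx⟩ := (E.surjective.comp (jrad Λ P).mkQ_surjective) ((jrad Λ (RepSpace K d τ)).mkQ y)
    have h1 : (jrad Λ (RepSpace K d τ)).mkQ (f x) = (jrad Λ (RepSpace K d τ)).mkQ y :=
      (LinearMap.congr_fun hf x).trans hx
    have h2 : y - f x ∈ jrad Λ (RepSpace K d τ) := by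
      rw [← Submodule.ker_mkQ (jrad Λ (RepSpace K d τ)), LinearMap.mem_ker, map_sub, h1, sub_self]
    have := Submodule.add_mem_sup (LinearMap.mem_range_self f x) h2
    simpa using this
  let g : (P ⧸ C) →ₗ[Λ] RepSpace K d τ := C.liftQ f (fun c hc => hkill f c hc)
  have hgs : Function.Surjective g := fun y => by
    obtain ⟨x, hx⟩ := hfs y
    exact ⟨C.mkQ x, hx⟩
  have hgi : Function.Injective g :=
    (LinearMap.injective_iff_surjective_of_finrank_eq_finrank (f := g.restrictScalars K)
      (hd.trans hrk.symm)).2 hgs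
  exact ⟨(e.trans (LinearEquiv.ofBijective g ⟨hgi, hgs⟩)).symm⟩

end PartD

section PartE
set_option linter.unusedSectionVars false

variable {K Λ : Type} [Field K] [Ring Λ] [Algebra K Λ]
variable {P M N Y X A B : Type}
  [AddCommGroup P] [Module Λ P] [Module K P] [IsScalarTower K Λ P]
  [AddCommGroup M] [Module Λ M] [Module K M] [IsScalarTower K Λ M]
  [AddCommGroup N] [Module Λ N] [Module K N] [IsScalarTower K Λ N]
  [AddCommGroup Y] [Module Λ Y] [Module K Y] [IsScalarTower K Λ Y]
  [AddCommGroup X] [Module Λ X] [Module K X] [IsScalarTower K Λ X]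
  [AddCommGroup A] [Module Λ A] [Module K A] [IsScalarTower K Λ A]
  [AddCommGroup B] [Module Λ B] [Module K B] [IsScalarTower K Λ B]

/-- No proper top-stable degeneration. -/
def NPD {ι : Type} [Fintype ι] (b : Basis ι K Λ) (d : ℕ) (M : Type) [AddCommGroup M] [Module Λ M] :
    Prop :=
  ∀ ρ τ : Λ →ₐ[K] Matrix (Fin d) (Fin d) K,
        Nonempty (RepSpace K d ρ ≃ₗ[Λ] M) →
        IsDegeneration b d ρ τ →
        Nonempty ((RepSpace K d τ ⧸ jrad Λ (RepSpace K d τ)) ≃ₗ[Λ]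
          (RepSpace K d ρ ⧸ jrad Λ (RepSpace K d ρ))) →
        Nonempty (RepSpace K d τ ≃ₗ[Λ] RepSpace K d ρ)

lemma use_hyp [Infinite K] [FiniteDimensional K Y] [FiniteDimensional K N] [FiniteDimensional K M]
    {ι : Type} [Fintype ι]
    (b : Basis ι K Λ) {d : ℕ} (hyp : NPD b d M) (hM : finrank K M = d)
    (q0 : Y →ₗ[Λ] N) (hq0 : Function.Surjective q0) (σ : Y →ₗ[K] Y)
    (H : ∀ s : K, s ≠ 0 → ∃ q : Y →ₗ[Λ] M, Function.Surjective q ∧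
      ∀ x, q0 x = 0 → q (x + s • σ x) = 0)
    (hN : finrank K N = d)
    (htop : Nonempty ((N ⧸ jrad Λ N) ≃ₗ[Λ] (M ⧸ jrad Λ M))) : Nonempty (N ≃ₗ[Λ] M) := by
  obtain ⟨e⟩ := repOf_equiv (Λ := Λ) (Module.finBasisOfFinrankEq K M hM)
  obtain ⟨τ, ⟨e'⟩, hdeg⟩ := degen b q0 hq0 σ H hN hM _ e
  obtain ⟨et⟩ := htop
  obtain ⟨e1⟩ := top_equiv_of_equiv e
  obtain ⟨e2⟩ := top_equiv_of_equiv e'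
  obtain ⟨e3⟩ := hyp _ τ ⟨e⟩ hdeg ⟨(e2.symm.trans et).trans e1⟩
  exact ⟨(e'.symm.trans e3).trans e⟩

lemma finrank_exact [FiniteDimensional K X] (i : A →ₗ[Λ] X) (p : X →ₗ[Λ] B)
    (hi : Function.Injective i) (hp : Function.Surjective p)
    (h : ∀ x, p x = 0 ↔ ∃ a, i a = x) : finrank K X = finrank K A + finrank K B := by
  have h1 := LinearMap.finrank_range_add_finrank_ker (p.restrictScalars K)
  have h2 : LinearMap.range (p.restrictScalars K) = ⊤ := LinearMap.range_eq_top.2 hp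
  have h3 := LinearMap.finrank_range_of_inj (f := i.restrictScalars K) hi
  have h4 : LinearMap.ker (p.restrictScalars K) = LinearMap.range (i.restrictScalars K) := by
    ext x
    exact h x
  rw [h2, h4, finrank_top, h3] at h1
  omega

lemma finrank_equiv (e : X ≃ₗ[Λ] Y) : finrank K X = finrank K Y :=
  (e.restrictScalars K).finrank_eq

lemma finrank_map_add [FiniteDimensional K X] (f : X →ₗ[Λ] Y) (V : Submodule Λ X) :
    finrank K V = finrank K (V ⊓ LinearMap.ker f : Submodule Λ X) + finrank K (V.map f) := by
  have := fd_sub (K := K) V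
  refine finrank_exact (Λ := Λ) (Submodule.inclusion inf_le_left) (f.submoduleMap V)
    (Submodule.inclusion_injective _) (f.submoduleMap_surjective V) ?_
  rintro ⟨x, hx⟩
  constructor
  · intro h
    exact ⟨⟨x, hx, congrArg Subtype.val h⟩, rfl⟩
  · rintro ⟨⟨a, ha1, ha2⟩, ha⟩
    have : a = x := congrArg Subtype.val ha
    subst this
    exact Subtype.ext ha2

lemma eq_of_le_finrank [FiniteDimensional K X] (V W : Submodule Λ X) (h : V ≤ W)
    (hr : finrank K V = finrank K W) : V = W := by
  have : V.restrictScalars K = W.restrictScalars K :=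
    Submodule.eq_of_le_of_finrank_eq h hr
  exact Submodule.restrictScalars_injective K Λ X this

lemma core [Infinite K] [FiniteDimensional K Λ] [FiniteDimensional K P]
    {ι : Type} [Fintype ι] (b : Basis ι K Λ) {d : ℕ} (C : Submodule Λ P) (hC : C ≤ jrad Λ P)
    (hd : finrank K (P ⧸ C) = d) (hyp : NPD b d (P ⧸ C))
    (n : P →ₗ[Λ] P) (hn : LinearMap.range n ≤ jrad Λ P) (hn2 : ∀ c ∈ C, n (n c) ∈ C) :
    ∀ c ∈ C, n c ∈ C := by
  have hA : IsArtinianRing Λ := isArtinian_of_tower K inferInstance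
  have hF : Module.Finite Λ P := Module.Finite.of_restrictScalars_finite K Λ _
  let C' : Submodule Λ P := C ⊓ C.comap n
  have hC'n : ∀ c ∈ C', n c ∈ C' := fun c hc => ⟨hc.2, hn2 c hc.1⟩
  let ψ : (C' × C) →ₗ[Λ] P := C'.subtype.coprod (n.comp C.subtype)
  have hψ : ∀ x, ψ x = (x.1 : P) + n x.2 := fun x => rfl
  let D : Submodule Λ P := LinearMap.range ψ
  have hD : D ≤ jrad Λ P := by
    rintro _ ⟨x, rfl⟩
    rw [hψ]
    exact add_mem (hC x.1.2.1) (hn ⟨_, rfl⟩)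
  have := fd_sub (K := K) C
  have := fd_sub (K := K) C'
  have := fd_sub (K := K) D
  have := fd_quot (K := K) C
  have := fd_quot (K := K) D
  have hDC : finrank K D = finrank K C := by
    let nC : C' →ₗ[Λ] C' := n.restrict hC'n
    let i : C' →ₗ[Λ] C' × C := (-nC).prod (Submodule.inclusion inf_le_left)
    have := finrank_exact (K := K) (Λ := Λ) i ψ.rangeRestrict ?_ ψ.surjective_rangeRestrict ?_
    · rw [Module.finrank_prod] at this
      change _ = _ + finrank K D at this
      omega
    · intro u v h
      exact Submodule.inclusion_injective _ (congrArg Prod.snd h)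
    · rintro ⟨⟨c', hc'⟩, ⟨c, hc⟩⟩
      constructor
      · intro h
        have h0 : c' + n c = 0 := congrArg Subtype.val h
        have h1 : n c = -c' := by rw [eq_neg_iff_add_eq_zero, add_comm]; exact h0
        refine ⟨⟨c, hc, ?_⟩, ?_⟩
        · change n c ∈ C
          rw [h1]; exact neg_mem hc'.1
        · ext
          · change -(n c) = c'
            rw [h1, neg_neg]
          · rfl
      · rintro ⟨⟨a, ha⟩, hh⟩
        have e1 : -(n a) = c' := congrArg (fun x => (x.1 : P)) hh
        have e2 : a = c := congrArg (fun x => (x.2 : P)) hh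
        apply Subtype.ext
        change c' + n c = 0
        rw [← e1, ← e2, neg_add_cancel]
  have hq : finrank K (P ⧸ D) = d := by
    have h1 := finrank_exact (K := K) D.subtype D.mkQ D.injective_subtype D.mkQ_surjective
      (fun x => by simp)
    have h2 := finrank_exact (K := K) C.subtype C.mkQ C.injective_subtype C.mkQ_surjective
      (fun x => by simp)
    omega
  let ψK : (C' × C) →ₗ[K] P := ψ.restrictScalars K
  obtain ⟨r, hr⟩ := ψK.rangeRestrict.exists_rightInverse_of_surjective
    (LinearMap.range_rangeRestrict ψK)
  obtain ⟨σ, hσ⟩ := LinearMap.exists_extend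
    (((C.subtype.restrictScalars K).comp (LinearMap.snd K C' C)).comp r)
  have hσ' : ∀ x ∈ D, ∃ c' ∈ C', ∃ c ∈ C, x = c' + n c ∧ σ x = c := by
    intro x hx
    let x' : LinearMap.range ψK := ⟨x, hx⟩
    refine ⟨(r x').1, (r x').1.2, (r x').2, (r x').2.2, ?_, ?_⟩
    · exact (congrArg Subtype.val (LinearMap.congr_fun hr x')).symm
    · exact LinearMap.congr_fun hσ x'
  obtain ⟨e1⟩ := top_equiv_of_ker_le C.mkQ C.mkQ_surjective (by simpa using hC)
  obtain ⟨e2⟩ := top_equiv_of_ker_le D.mkQ D.mkQ_surjective (by simpa using hD)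
  obtain ⟨e⟩ : Nonempty ((P ⧸ D) ≃ₗ[Λ] (P ⧸ C)) := by
    refine use_hyp b hyp hd D.mkQ D.mkQ_surjective σ ?_ hq ⟨e2.trans e1.symm⟩
    intro s hs
    let u : P →ₗ[Λ] P := s • LinearMap.id + n
    have hu : ∀ x, u x = s • x + n x := fun x => rfl
    have hus : Function.Surjective u := by
      apply nakayama_surj
      rw [eq_top_iff]
      intro x _
      have h1 : n (s⁻¹ • x) ∈ jrad Λ P := hn ⟨_, rfl⟩
      have h2 := Submodule.add_mem_sup (LinearMap.mem_range_self u (s⁻¹ • x)) (neg_mem h1)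
      rw [hu, smul_smul, mul_inv_cancel₀ hs, one_smul] at h2
      simpa using h2
    have hui : Function.Injective u :=
      (LinearMap.injective_iff_surjective (f := u.restrictScalars K)).2 hus
    let ue := LinearEquiv.ofBijective u ⟨hui, hus⟩
    have huC : ∀ c ∈ C', u c ∈ C' := fun c hc => by
      rw [hu]
      refine add_mem ?_ (hC'n c hc)
      exact (C'.restrictScalars K).smul_mem s hc
    let uC : C' →ₗ[Λ] C' := u.restrict huC
    have huCi : Function.Injective uC := fun x y h => Subtype.ext (hui (congrArg Subtype.val h))
    have huCs : Function.Surjective uC :=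
      (LinearMap.injective_iff_surjective (f := uC.restrictScalars K)).1 huCi
    refine ⟨C.mkQ.comp ue.symm.toLinearMap, C.mkQ_surjective.comp ue.symm.surjective, ?_⟩
    intro x hx
    have hx' : x ∈ D := by simpa using hx
    obtain ⟨c', hc', c, hc, hxc, hσx⟩ := hσ' x hx'
    obtain ⟨⟨w, hw⟩, hw'⟩ := huCs ⟨c', hc'⟩
    have hw2 : u w = c' := congrArg Subtype.val hw'
    have h3 : x + s • σ x = ue (w + c) := by
      change _ = u (w + c)
      rw [map_add, hw2, hσx, hxc, hu]
      abel
    rw [h3]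
    simp only [LinearMap.comp_apply, LinearEquiv.coe_coe, LinearEquiv.symm_apply_apply]
    rw [← LinearMap.mem_ker, Submodule.ker_mkQ]
    exact add_mem hw.1 hc
  have hfr : ∀ i, finrank K (jpow (Λ := Λ) i P ⊓ C : Submodule Λ P) =
      finrank K (jpow (Λ := Λ) i P ⊓ D : Submodule Λ P) := by
    intro i
    have h1 := finrank_map_add (K := K) C.mkQ (jpow (Λ := Λ) i P)
    have h2 := finrank_map_add (K := K) D.mkQ (jpow (Λ := Λ) i P)
    rw [jpow_map_surj _ _ C.mkQ_surjective, Submodule.ker_mkQ] at h1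
    rw [jpow_map_surj _ _ D.mkQ_surjective, Submodule.ker_mkQ] at h2
    have h3 := finrank_equiv (K := K) (e.submoduleMap (jpow i (P ⧸ D)))
    have h4 := jpow_map_surj i e.toLinearMap e.surjective
    have h5 : finrank K (jpow (Λ := Λ) i (P ⧸ D)) = finrank K (jpow (Λ := Λ) i (P ⧸ C)) := by
      rw [← h4]; exact h3
    omega
  by_contra hcon
  push Not at hcon
  obtain ⟨z, hz, hnz⟩ := hcon
  classical
  obtain ⟨m, hm⟩ := jpow_eventually (Λ := Λ)
  have hex : ∃ j, jpow (Λ := Λ) j P ⊓ C ≤ C' := ⟨m, by rw [hm]; simp⟩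
  have hj := Nat.find_spec hex
  have hjmin := fun k => Nat.find_min hex (m := k)
  generalize Nat.find hex = j at hj hjmin
  cases j with
  | zero =>
    rw [jpow_zero, top_inf_eq] at hj
    exact hnz (hj hz).2
  | succ i =>
    have h1 := hjmin i (Nat.lt_succ_self i)
    rw [SetLike.not_le_iff_exists] at h1
    obtain ⟨c, ⟨hci, hcC⟩, hcC'⟩ := h1
    have hle : jpow (Λ := Λ) (i + 1) P ⊓ C ≤ jpow (Λ := Λ) (i + 1) P ⊓ D := by
      intro x hx
      refine ⟨hx.1, ⟨(⟨x, hj hx⟩, 0), ?_⟩⟩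
      rw [hψ]; simp
    have heq := eq_of_le_finrank (K := K) _ _ hle (hfr _)
    have hnc : n c ∈ jpow (Λ := Λ) (i + 1) P ⊓ D := by
      refine ⟨jpow_add_map n 1 i (by rw [jpow_one]; exact hn) ⟨c, hci, rfl⟩, ⟨(0, ⟨c, hcC⟩), ?_⟩⟩
      rw [hψ]; simp
    rw [← heq] at hnc
    exact hcC' ⟨hcC, hnc.2⟩

lemma stab [Infinite K] [FiniteDimensional K Λ] [FiniteDimensional K P]
    {ι : Type} [Fintype ι] (b : Basis ι K Λ) {d : ℕ} (C : Submodule Λ P) (hC : C ≤ jrad Λ P)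
    (hd : finrank K (P ⧸ C) = d) (hyp : NPD b d (P ⧸ C))
    (n : P →ₗ[Λ] P) (hn : LinearMap.range n ≤ jrad Λ P) :
    ∀ c ∈ C, n c ∈ C := by
  have hA : IsArtinianRing Λ := isArtinian_of_tower K inferInstance
  obtain ⟨m, hm⟩ := jpow_eventually (Λ := Λ)
  have main : ∀ j k, 1 ≤ k → m ≤ k + j → ∀ n : P →ₗ[Λ] P, LinearMap.range n ≤ jpow k P →
      ∀ c ∈ C, n c ∈ C := by
    intro j
    induction j with
    | zero =>
      intro k hk hmk n hn c hc
      have h1 : n c ∈ jpow (Λ := Λ) m P := jpow_anti (by simpa using hmk) (hn ⟨c, rfl⟩)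
      rw [hm, Submodule.mem_bot] at h1
      rw [h1]; exact zero_mem _
    | succ j ih =>
      intro k hk hmk n hn
      have hn1 : LinearMap.range n ≤ jrad Λ P := by
        rw [← jpow_one]; exact hn.trans (jpow_anti hk)
      refine core b C hC hd hyp n hn1 ?_
      refine ih (k + 1) (by omega) (by omega) (n.comp n) ?_
      rintro _ ⟨x, rfl⟩
      have h1 := jpow_add_map n k k hn ⟨n x, hn ⟨x, rfl⟩, rfl⟩
      exact jpow_anti (show k + 1 ≤ k + k by omega) h1
  exact main m 1 le_rfl (by omega) n (by rwa [jpow_one])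

lemma step1 [Infinite K] [FiniteDimensional K Λ] [FiniteDimensional K P]
    {ι : Type} [Fintype ι] (b : Basis ι K Λ) {d : ℕ} (hproj : Module.Projective Λ P)
    (C : Submodule Λ P) (hC : C ≤ jrad Λ P)
    (hd : finrank K (P ⧸ C) = d) (hyp : NPD b d (P ⧸ C)) :
    ∀ f : P →ₗ[Λ] jrad Λ (P ⧸ C), ∀ c ∈ C, f c = 0 := by
  intro f c hc
  have hj := jrad_map_surj C.mkQ C.mkQ_surjective
  let g : jrad Λ P →ₗ[Λ] jrad Λ (P ⧸ C) := C.mkQ.restrict (fun x hx => jrad_apply _ hx)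
  have hg : Function.Surjective g := by
    rintro ⟨y, hy⟩
    rw [← hj] at hy
    obtain ⟨x, hx, rfl⟩ := hy
    exact ⟨⟨x, hx⟩, rfl⟩
  obtain ⟨h, hh⟩ := Module.projective_lifting_property g f hg
  have h1 := stab b C hC hd hyp ((jrad Λ P).subtype.comp h) (by
    rintro _ ⟨x, rfl⟩; exact (h x).2) c hc
  rw [← hh]
  apply Subtype.ext
  change C.mkQ (h c : P) = 0
  simpa using h1

end PartE

section PartF
set_option linter.unusedSectionVars false

variable {K Λ : Type} [Field K] [Ring Λ] [Algebra K Λ]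
variable {M X Y L : Type}
  [AddCommGroup M] [Module Λ M] [Module K M] [IsScalarTower K Λ M]
  [AddCommGroup Y] [Module Λ Y]
  [AddCommGroup X] [Module Λ X]
  [AddCommGroup L] [Module Λ L]

/-- Direct sum of local modules. -/
def SumLoc (Λ X : Type) [Ring Λ] [AddCommGroup X] [Module Λ X] : Prop :=
  ∃ (m : ℕ) (Q : Fin m → Submodule Λ X), iSupIndep Q ∧ (⨆ i, Q i) = ⊤ ∧
        ∀ i, IsSimpleModule Λ (↥(Q i) ⧸ jrad Λ ↥(Q i))

lemma local_congr (e : X ≃ₗ[Λ] Y) (h : IsSimpleModule Λ (X ⧸ jrad Λ X)) :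
    IsSimpleModule Λ (Y ⧸ jrad Λ Y) := by
  obtain ⟨e1⟩ := top_equiv_of_equiv e
  exact IsSimpleModule.congr e1

lemma sumLoc_congr (e : X ≃ₗ[Λ] Y) (h : SumLoc Λ X) : SumLoc Λ Y := by
  obtain ⟨m, Q, h1, h2, h3⟩ := h
  refine ⟨m, fun i => (Q i).map e.toLinearMap, LinearMap.iSupIndep_map _ e.injective h1, ?_, ?_⟩
  · rw [← Submodule.map_iSup, h2, Submodule.map_top]
    exact LinearMap.range_eq_top.2 e.surjective
  · intro i
    exact local_congr (e.submoduleMap (Q i)) (h3 i)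

lemma sumLoc_prod (h : SumLoc Λ X) (hL : IsSimpleModule Λ (L ⧸ jrad Λ L)) : SumLoc Λ (X × L) := by
  obtain ⟨m, Q, h1, h2, h3⟩ := h
  let Q' : Fin (m + 1) → Submodule Λ (X × L) := fun j =>
    Fin.cases (LinearMap.range (LinearMap.inr Λ X L)) (fun i => (Q i).map (LinearMap.inl Λ X L)) j
  have hQ0 : Q' 0 = LinearMap.range (LinearMap.inr Λ X L) := rfl
  have hQs : ∀ i : Fin m, Q' i.succ = (Q i).map (LinearMap.inl Λ X L) := fun i => rfl
  refine ⟨m + 1, Q', ?_, ?_, ?_⟩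
  · rw [iSupIndep_def]
    intro j
    rw [Submodule.disjoint_def]
    refine Fin.cases ?_ (fun i => ?_) j
    · intro x hx hx'
      have hle : (⨆ (j) (_ : j ≠ 0), Q' j) ≤ LinearMap.range (LinearMap.inl Λ X L) := by
        refine iSup₂_le fun k hk => ?_
        obtain ⟨k, rfl⟩ := Fin.exists_succ_eq.2 hk
        rw [hQs]
        rintro _ ⟨y, _, rfl⟩
        exact ⟨y, rfl⟩
      obtain ⟨a, rfl⟩ := hle hx'
      rw [hQ0] at hx
      obtain ⟨l, hl⟩ := hx
      have : (0 : X) = a := congrArg Prod.fst hl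
      rw [← this]; simp
    · intro x hx hx'
      have hle : (⨆ (j) (_ : j ≠ i.succ), Q' j) ≤ (⨆ (j) (_ : j ≠ i), Q j).prod ⊤ := by
        refine iSup₂_le fun k => ?_
        refine Fin.cases ?_ (fun k => ?_) k
        · intro _
          rw [hQ0]
          rintro _ ⟨y, rfl⟩
          exact ⟨zero_mem _, trivial⟩
        · intro hk
          rw [hQs]
          rintro _ ⟨y, hy, rfl⟩
          refine ⟨?_, trivial⟩
          have hk' : k ≠ i := fun h => hk (by rw [h])
          exact le_iSup₂ (f := fun (j : Fin m) (_ : j ≠ i) => Q j) k hk' hy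
      rw [hQs] at hx
      obtain ⟨y, hy, rfl⟩ := hx
      have h4 := (hle hx').1
      have := (Submodule.disjoint_def.1 (iSupIndep_def.1 h1 i)) y hy h4
      rw [this, map_zero]
  · rw [eq_top_iff]
    rintro ⟨x, l⟩ _
    have hx : (x, (0 : L)) ∈ ⨆ i, Q' i := by
      have : (⨆ i, Q i).map (LinearMap.inl Λ X L) ≤ ⨆ i, Q' i := by
        rw [Submodule.map_iSup]
        exact iSup_le fun i => le_iSup Q' i.succ
      exact this ⟨x, by rw [h2]; trivial, rfl⟩
    have hl : ((0 : X), l) ∈ ⨆ i, Q' i := le_iSup Q' 0 ⟨l, rfl⟩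
    simpa using add_mem hx hl
  · intro j
    refine Fin.cases ?_ (fun i => ?_) j
    · exact local_congr (LinearEquiv.ofInjective (LinearMap.inr Λ X L) LinearMap.inr_injective) hL
    · exact local_congr (Submodule.equivMapOfInjective (LinearMap.inl Λ X L)
        LinearMap.inl_injective (Q i)) (h3 i)

/-- Good submodules. -/
def Good (U : Submodule Λ M) : Prop :=
  U ⊓ jrad Λ M ≤ (jrad Λ U).map U.subtype ∧ SumLoc Λ U

lemma split_of_good [Infinite K] [FiniteDimensional K Λ] [FiniteDimensional K M]
    {ι : Type} [Fintype ι] (b : Basis ι K Λ) {d : ℕ}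
    (hd : finrank K M = d) (hyp : NPD b d M) (U : Submodule Λ M)
    (hU : U ⊓ jrad Λ M ≤ (jrad Λ U).map U.subtype) : Nonempty ((U × (M ⧸ U)) ≃ₗ[Λ] M) := by
  have hA : IsArtinianRing Λ := isArtinian_of_tower K inferInstance
  have := fd_sub (K := K) U
  have := fd_quot (K := K) U
  obtain ⟨r, hr⟩ := (U.subtype.restrictScalars K).exists_leftInverse_of_injective
    (LinearMap.ker_eq_bot.2 U.injective_subtype)
  have hr' : ∀ u : U, r u = u := fun u => LinearMap.congr_fun hr u
  let q0 : (U × M) →ₗ[Λ] (U × (M ⧸ U)) := LinearMap.prodMap LinearMap.id U.mkQ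
  have hq0 : Function.Surjective q0 := by
    rintro ⟨u, z⟩
    obtain ⟨m, rfl⟩ := U.mkQ_surjective z
    exact ⟨(u, m), rfl⟩
  have hk : ∀ u m, q0 (u, m) = 0 ↔ u = 0 ∧ m ∈ U := by
    intro u m
    simp [q0]
  refine use_hyp b hyp hd q0 hq0
    ((LinearMap.inl K U M).comp (r.comp (LinearMap.snd K U M))) ?_ ?_ ?_
  · intro s hs
    refine ⟨LinearMap.coprod (-(s⁻¹ • U.subtype)) LinearMap.id, fun m => ⟨(0, m), by simp⟩, ?_⟩
    rintro ⟨u, m⟩ hx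
    obtain ⟨rfl, hm⟩ := (hk u m).1 hx
    have h1 : (r m : M) = m := congrArg Subtype.val (hr' ⟨m, hm⟩)
    have h2 : ((s • r m : U) : M) = s • m := by
      change s • (r m : M) = s • m
      rw [h1]
    simp only [LinearMap.comp_apply, LinearMap.snd_apply, LinearMap.inl_apply, Prod.smul_mk,
      smul_zero, Prod.mk_add_mk, zero_add, add_zero, LinearMap.coprod_apply, LinearMap.neg_apply,
      LinearMap.smul_apply, LinearMap.id_apply, Submodule.subtype_apply]
    rw [h2, smul_smul, inv_mul_cancel₀ hs, one_smul, neg_add_cancel]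
  · have h2 := finrank_exact (K := K) U.subtype U.mkQ U.injective_subtype U.mkQ_surjective
      (fun x => by simp)
    rw [Module.finrank_prod]
    omega
  · have hss : IsSemisimpleModule Λ (M ⧸ jrad Λ M) := semisimple_top
    let π := (jrad Λ M).mkQ
    let S : Submodule Λ (M ⧸ jrad Λ M) := LinearMap.range (π.comp U.subtype)
    obtain ⟨h, hh⟩ := IsSemisimpleModule.extension_property S.subtype S.injective_subtype
      LinearMap.id
    let ε := S.subtype.comp h
    have hε1 : ∀ x ∈ S, ε x = x := fun x hx =>
      congrArg Subtype.val (LinearMap.congr_fun hh ⟨x, hx⟩)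
    have hε2 : ∀ x, ε x ∈ S := fun x => (h x).2
    have hπU : ∀ u : U, π u ∈ S := fun u => ⟨u, rfl⟩
    let g : (U × M) →ₗ[Λ] (M ⧸ jrad Λ M) :=
      LinearMap.coprod (π.comp U.subtype) (π - ε.comp π)
    have hg : ∀ u m, g (u, m) = π u + (π m - ε (π m)) := fun u m => rfl
    refine top_equiv_of q0 hq0 g ?_ ?_
    · intro z
      obtain ⟨m, rfl⟩ := (jrad Λ M).mkQ_surjective z
      obtain ⟨u, hu⟩ := hε2 (π m)
      refine ⟨(u, m), ?_⟩
      have hu' : π u = ε (π m) := hu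
      rw [hg, hu']
      change _ = π m
      abel
    · apply le_antisymm
      · rintro ⟨u, m⟩ hx
        have h0 : π u + (π m - ε (π m)) = 0 := hx
        have h1 := congrArg ε h0
        rw [map_add, map_sub, hε1 _ (hε2 _), sub_self, add_zero, map_zero, hε1 _ (hπU u)] at h1
        have hu : (u : M) ∈ jrad Λ M := by simpa [π] using h1
        obtain ⟨u1, hu1, hu2⟩ := hU ⟨u.2, hu⟩
        have hu3 : u1 = u := Subtype.ext hu2
        rw [hu3] at hu1
        rw [h1, zero_add, sub_eq_zero] at h0
        obtain ⟨u', hu'⟩ := hε2 (π m)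
        have hu'' : π u' = π m := hu'.trans h0.symm
        have hm : m - u' ∈ jrad Λ M := by
          rw [← Submodule.ker_mkQ (jrad Λ M), LinearMap.mem_ker, map_sub]
          exact sub_eq_zero.2 hu''.symm
        have := Submodule.add_mem_sup (jrad_prod.2 ⟨hu1, hm⟩)
          (LinearMap.mem_ker.2 ((hk 0 u').2 ⟨rfl, u'.2⟩))
        simpa using this
      · refine sup_le ?_ ?_
        · intro x hx
          have := jrad_apply g hx
          have h9 : jrad Λ (M ⧸ jrad Λ M) = ⊥ := jrad_semisimple
          rw [h9, Submodule.mem_bot] at this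
          exact this
        · rintro ⟨u, m⟩ hx
          obtain ⟨rfl, hm⟩ := (hk u m).1 hx
          rw [LinearMap.mem_ker, hg, hε1 _ (hπU ⟨m, hm⟩)]
          simp

lemma good_step [Infinite K] [FiniteDimensional K Λ] [FiniteDimensional K M]
    {ι : Type} [Fintype ι] (b : Basis ι K Λ) {d : ℕ}
    (hd : finrank K M = d) (hyp : NPD b d M) (U : Submodule Λ M)
    (hU : Good U) (hne : U ≠ ⊤) : ∃ U' : Submodule Λ M, Good U' ∧ finrank K U < finrank K U' := by
  have hA : IsArtinianRing Λ := isArtinian_of_tower K inferInstance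
  have := fd_sub (K := K) U
  have := fd_quot (K := K) U
  have hF : Module.Finite Λ (M ⧸ U) := Module.Finite.of_restrictScalars_finite K Λ _
  have hnt : Nontrivial (M ⧸ U) := Submodule.Quotient.nontrivial_iff.2 hne
  obtain ⟨E⟩ := split_of_good b hd hyp U hU.1
  obtain ⟨L, hL0, hL, hLJ⟩ := exists_local (Λ := Λ) (Y := M ⧸ U)
  have := fd_sub (K := K) L
  let F : (U × L) →ₗ[Λ] M := E.toLinearMap.comp (LinearMap.prodMap LinearMap.id L.subtype)
  have hF : ∀ u l, F (u, l) = E (u, (l : M ⧸ U)) := fun u l => rfl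
  have hFi : Function.Injective F := by
    rintro ⟨u, l⟩ ⟨u', l'⟩ h
    have := E.injective h
    simp only [LinearMap.prodMap_apply, Prod.mk.injEq] at this
    exact Prod.ext this.1 (Subtype.ext this.2)
  let e := LinearEquiv.ofInjective F hFi
  refine ⟨LinearMap.range F, ⟨?_, sumLoc_congr e (sumLoc_prod hU.2 hL)⟩, ?_⟩
  · rintro _ ⟨⟨⟨u, l⟩, rfl⟩, hx⟩
    have h1 := jrad_apply E.symm.toLinearMap hx
    rw [hF] at h1
    simp only [LinearEquiv.coe_coe, LinearEquiv.symm_apply_apply] at h1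
    obtain ⟨hu, hl⟩ := jrad_prod.1 h1
    obtain ⟨l', hl', hll⟩ := hLJ ⟨l.2, hl⟩
    have : l' = l := Subtype.ext hll
    rw [this] at hl'
    exact ⟨e (u, l), jrad_apply e.toLinearMap (jrad_prod.2 ⟨hu, hl'⟩), rfl⟩
  · rw [← finrank_equiv (K := K) e, Module.finrank_prod]
    have : Nontrivial L := (Submodule.nontrivial_iff_ne_bot).2 hL0
    have := Module.finrank_pos (R := K) (M := L)
    omega

lemma step2 [Infinite K] [FiniteDimensional K Λ] [FiniteDimensional K M]
    {ι : Type} [Fintype ι] (b : Basis ι K Λ) {d : ℕ}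
    (hd : finrank K M = d) (hyp : NPD b d M) : SumLoc Λ M := by
  have main : ∀ k (U : Submodule Λ M), Good U → finrank K M ≤ finrank K U + k → SumLoc Λ M := by
    intro k
    induction k with
    | zero =>
      intro U hU hk
      by_cases hne : U = ⊤
      · subst hne
        exact sumLoc_congr Submodule.topEquiv hU.2
      · obtain ⟨U', hU', hlt⟩ := good_step b hd hyp U hU hne
        have : finrank K U' ≤ finrank K M := Submodule.finrank_le (U'.restrictScalars K)
        omega
    | succ k ih =>
      intro U hU hk
      by_cases hne : U = ⊤
      · subst hne
        exact sumLoc_congr Submodule.topEquiv hU.2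
      · obtain ⟨U', hU', hlt⟩ := good_step b hd hyp U hU hne
        exact ih U' hU' (by omega)
  refine main (finrank K M) ⊥ ⟨?_, 0, fun i => i.elim0, ?_, ?_, fun i => i.elim0⟩ (by omega)
  · rw [bot_inf_eq]; exact bot_le
  · exact iSupIndep_subsingleton _
  · exact Subsingleton.elim _ _

end PartF

/-- Let `T` be a squarefree semisimple `Λ`-module with exactly `t` simple
direct summands, `P` a projective cover of `T`, `C ⊆ JP` a submodule and `M = P/C`.  Then `M`
has no proper top-stable degeneration if and only if `M` is a direct sum of local modules and
`μ_T(M) = t + dim_K Hom_Λ(M, JM)`. -/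
theorem stmt7 {K Λ ι : Type} [Field K] [IsAlgClosed K] [Ring Λ] [Algebra K Λ]
    [FiniteDimensional K Λ] [Fintype ι] (b : Basis ι K Λ)
    (T : Type) [AddCommGroup T] [Module Λ T] [Module K T] [IsScalarTower K Λ T]
    [FiniteDimensional K T]
    (P : Type) [AddCommGroup P] [Module Λ P] [Module K P] [IsScalarTower K Λ P]
    [SMulCommClass Λ K P] [FiniteDimensional K P]
    -- `T` is semisimple and squarefree:
    (hss : IsSemisimpleModule Λ T)
    (hsf : ∀ S S' : Submodule Λ T, IsSimpleModule Λ ↥S → IsSimpleModule Λ ↥S' →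
        Nonempty (↥S ≃ₗ[Λ] ↥S') → S = S')
    -- `T` has exactly `t` simple direct summands (for squarefree semisimple `T` these are
    -- exactly the simple submodules of `T`):
    (t : ℕ) (ht : Nat.card {S : Submodule Λ T // IsSimpleModule Λ ↥S} = t)
    -- `P` is a projective cover of `T`:
    (hproj : Module.Projective Λ P)
    (hcover : Nonempty ((P ⧸ jrad Λ P) ≃ₗ[Λ] T))
    (C : Submodule Λ P) (hC : C ≤ jrad Λ P)
    -- `d` is the `K`-dimension of `M = P/C`:
    (d : ℕ) (hd : finrank K (P ⧸ C) = d) :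
    -- `M = P/C` has no proper top-stable degeneration ...
    (∀ ρ τ : Λ →ₐ[K] Matrix (Fin d) (Fin d) K,
        Nonempty (RepSpace K d ρ ≃ₗ[Λ] (P ⧸ C)) →
        IsDegeneration b d ρ τ →
        Nonempty ((RepSpace K d τ ⧸ jrad Λ (RepSpace K d τ)) ≃ₗ[Λ]
          (RepSpace K d ρ ⧸ jrad Λ (RepSpace K d ρ))) →
        Nonempty (RepSpace K d τ ≃ₗ[Λ] RepSpace K d ρ))
    ↔
    -- ... iff `M` is a direct sum of local modules (modules with simple top) ...
    ((∃ (m : ℕ) (Q : Fin m → Submodule Λ (P ⧸ C)),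
        iSupIndep Q ∧ (⨆ i, Q i) = ⊤ ∧
        ∀ i, IsSimpleModule Λ (↥(Q i) ⧸ jrad Λ ↥(Q i))) ∧
    -- ... and `μ_T(M) = t + dim_K Hom_Λ(M, JM)`, where `μ_T(M)` is computed as the number of
    -- factors of any composition series of `M` isomorphic to a simple direct summand of `T`:
      (∀ s : CompositionSeries (Submodule Λ (P ⧸ C)), s.head = ⊥ → s.last = ⊤ →
        Nat.card {i : Fin s.length //
            ∃ S : Submodule Λ T, IsSimpleModule Λ ↥S ∧
              Nonempty ((↥(s.toFun i.succ) ⧸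
                Submodule.comap (s.toFun i.succ).subtype (s.toFun i.castSucc)) ≃ₗ[Λ] ↥S)} =
          t + finrank K ((P ⧸ C) →ₗ[Λ] ↥(jrad Λ (P ⧸ C))))) := by
  obtain ⟨E⟩ := hcover
  have := fd_quot (K := K) C
  rw [mu_iff hss hsf t ht hproj E C hC]
  constructor
  · intro hyp
    exact ⟨step2 b hd hyp, step1 b hproj C hC hd hyp⟩
  · rintro ⟨⟨m, Q, h1, h2, h3⟩, hk⟩ ρ τ ⟨e⟩ hdeg htop
    exact dir2 b hproj C hC (all_kill (K := K) hss hsf E C hk Q h1 h2 h3) d hd ρ τ e hdeg htop
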